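/- arXiv:1807.11134 — 2 statements merged into one kernel-verified Lean document; each statement's English description precedes it below -/
import Mathlib

section
/- Let $L$ be a finite-dimensional Lie algebra over a field $F$ of characteristic $p \ne 0$, and suppose $F$ is not algebraically closed. Then there exists a finite-dimensional faithful irreducible $L$-module, i.e., a finite-dimensional $L$-module $V$ with no proper nonzero submodules such that the representation $L \to \mathfrak{gl}(V)$ is injective. -/
/-- A bundled finite-dimensional faithful irreducible module over a Lie algebra. -/
structure FaithfulIrredMod (F L : Type) [Field F] [LieRing L] [LieAlgebra F L] where
  carrier : Type
  [isAddCommGroup : AddCommGroup carrier]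
  [isModule : Module F carrier]
  [isLieRingModule : LieRingModule L carrier]
  [isLieModule : LieModule F L carrier]
  finDim : FiniteDimensional F carrier
  irred : LieModule.IsIrreducible F L carrier
  faithful : Function.Injective (LieModule.toEnd F L carrier)

attribute [instance] FaithfulIrredMod.isAddCommGroup FaithfulIrredMod.isModule
  FaithfulIrredMod.isLieRingModule FaithfulIrredMod.isLieModule

section AlgebraicClosure

open Module Polynomial IntermediateField

universe u

/-- An algebraically closed field of characteristic `p` has no subfield of index `p`. -/
theorem finrank_ne_char_of_isAlgClosed {K C : Type*} [Field K] [Field C] [Algebra K C]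
    [IsAlgClosed C] [FiniteDimensional K C] [IsGalois K C] {p : ℕ} [hp : Fact p.Prime]
    [CharP K p] : finrank K C ≠ p := by
  intro hfin
  have : CharP C p := charP_of_injective_algebraMap (algebraMap K C).injective p
  have hcard : Nat.card Gal(C/K) = p := by rw [IsGalois.card_aut_eq_finrank, hfin]
  have : Nontrivial Gal(C/K) := Finite.one_lt_card_iff_nontrivial.mp (hcard ▸ hp.out.one_lt)
  obtain ⟨σ, hσ⟩ := exists_ne (1 : Gal(C/K))
  have htop : Subgroup.zpowers σ = ⊤ := zpowers_eq_top_of_prime_card hcard hσ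
  have hfix : ∀ x : C, σ x = x → x ∈ Set.range (algebraMap K C) := by
    intro x hx
    rw [IsGalois.mem_range_algebraMap_iff_fixed]
    intro τ
    have hτ : τ ∈ Subgroup.zpowers σ := htop ▸ Subgroup.mem_top τ
    have hle : Subgroup.zpowers σ ≤ MulAction.stabilizer Gal(C/K) x := by
      rw [Subgroup.zpowers_le]; exact hx
    exact hle hτ
  have hσp : σ ^ p = 1 := hcard ▸ pow_card_eq_one'
  let d : End K C := σ.toLinearMap - 1
  have hd : d ^ p = 0 := by
    have : CharP (End K C) p := charP_of_injective_algebraMap (algebraMap K (End K C)).injective p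
    rw [sub_pow_char_of_commute _ (Commute.one_right _), one_pow, sub_eq_zero]
    ext x
    rw [← AlgEquiv.pow_toLinearMap, hσp]; rfl
  have hd1 : ∃ y, d (d y) = 0 ∧ d y ≠ 0 := by
    have hex : ∃ k, d ^ k = 0 := ⟨p, hd⟩
    classical
    have h0 := Nat.find_spec hex
    obtain ⟨k, hk⟩ : ∃ k, Nat.find hex = k + 2 := by
      rcases h : Nat.find hex with _ | _ | k
      · rw [h] at h0; simp at h0
      · rw [h, zero_add, pow_one] at h0
        refine absurd ?_ hσ
        ext x
        simpa [d, sub_eq_zero] using LinearMap.congr_fun h0 x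
      · exact ⟨k, rfl⟩
    have hlt := Nat.find_min hex (m := k + 1) (by omega)
    obtain ⟨z, hz⟩ : ∃ z, (d ^ (k + 1)) z ≠ 0 := by
      by_contra! h
      exact hlt (LinearMap.ext h)
    refine ⟨(d ^ k) z, ?_, ?_⟩
    · rw [hk] at h0
      have := LinearMap.congr_fun h0 z
      rwa [pow_succ', pow_succ'] at this
    · rwa [pow_succ'] at hz
  obtain ⟨y, hy, hy0⟩ := hd1
  obtain ⟨c, hc⟩ := hfix (d y) (by simpa [d, sub_eq_zero] using hy)
  have hc0 : algebraMap K C c ≠ 0 := hc ▸ hy0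
  set α := y / algebraMap K C c with hα
  have hσα : σ α = α + 1 := by
    have : σ y = y + algebraMap K C c := by rw [hc]; simp [d]
    rw [hα, map_div₀, this, AlgEquiv.commutes, add_div, div_self hc0]
  obtain ⟨a, ha⟩ := hfix (α ^ p - α) (by
    rw [map_sub, map_pow, hσα, add_pow_char, one_pow]; ring)
  obtain ⟨t, ht⟩ := Algebra.trace_surjective K C a
  obtain ⟨s, hs⟩ : ∃ s : C, s ^ p - s = t := by
    have hdeg : (X ^ p - X - Polynomial.C t : C[X]).degree ≠ 0 := by
      have h1 : (X ^ p - (X + Polynomial.C t) : C[X]).natDegree = p := by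
        rw [natDegree_sub_eq_left_of_natDegree_lt] <;> simp [hp.out.one_lt]
      rw [sub_sub]
      exact (natDegree_pos_iff_degree_pos.mp (by rw [h1]; exact hp.out.pos)).ne'
    obtain ⟨s, hs⟩ := IsAlgClosed.exists_root _ hdeg
    exact ⟨s, by simpa [sub_eq_zero] using hs⟩
  have hb : (Algebra.trace K C s) ^ p - Algebra.trace K C s = a := by
    apply (algebraMap K C).injective
    rw [← ht, map_sub, map_pow, trace_eq_sum_automorphisms, trace_eq_sum_automorphisms, ← hs,
      sum_pow_char, ← Finset.sum_sub_distrib]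
    simp
  set b := Algebra.trace K C s
  have hβ : (α - algebraMap K C b) ^ p = α - algebraMap K C b := by
    rw [sub_pow_char, ← map_pow]
    have := congrArg (algebraMap K C) hb
    rw [ha, map_sub] at this
    linear_combination -this
  have hσβ : σ (α - algebraMap K C b) = α - algebraMap K C b := by
    rw [← Subfield.mem_bot_iff_pow_eq_self (F := C) (p := p)] at hβ
    have : (⊥ : Subfield C) ≤ (σ : C →+* C).eqLocusField (RingHom.id C) := bot_le
    exact this hβ
  rw [map_sub, hσα, AlgEquiv.commutes] at hσβ
  exact one_ne_zero (α := C) (by linear_combination hσβ)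

/-- In positive characteristic, an algebraically closed field has no subfield of prime index. -/
theorem finrank_not_prime_of_isAlgClosed {K C : Type*} [Field K] [Field C] [Algebra K C]
    [IsAlgClosed C] [FiniteDimensional K C] [IsGalois K C] {p : ℕ} [hp : Fact p.Prime]
    [CharP K p] : ¬ (finrank K C).Prime := by
  intro hℓ
  have hCp : CharP C p := charP_of_injective_algebraMap (algebraMap K C).injective p
  set ℓ := finrank K C with hℓdef
  have hℓp : ℓ ≠ p := finrank_ne_char_of_isAlgClosed
  have hℓC : ((ℓ : ℕ) : C) ≠ 0 := by
    rw [Ne, CharP.cast_eq_zero_iff C p, Nat.prime_dvd_prime_iff_eq hp.out hℓ]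
    exact hℓp.symm
  have hdeg : ∀ x : C, (minpoly K x).natDegree ≤ ℓ := fun x => minpoly.natDegree_le x
  have hroot : (primitiveRoots ℓ K).Nonempty := by
    have : NeZero ((ℓ : ℕ) : C) := ⟨hℓC⟩
    obtain ⟨ζ, hζ⟩ := HasEnoughRootsOfUnity.exists_primitiveRoot C ℓ
    have hgeom : aeval ζ (∑ i ∈ Finset.range ℓ, (X : K[X]) ^ i) = 0 := by
      simpa using hζ.geom_sum_eq_zero hℓ.one_lt
    have hne : (∑ i ∈ Finset.range ℓ, (X : K[X]) ^ i) ≠ 0 :=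
      (monic_geom_sum_X hℓ.ne_zero).ne_zero
    have hlt : (minpoly K ζ).natDegree < ℓ := by
      refine (natDegree_le_of_dvd (minpoly.dvd K ζ hgeom) hne).trans_lt ?_
      refine (natDegree_sum_le_of_forall_le _ _ (n := ℓ - 1) fun i hi => ?_).trans_lt
        (Nat.sub_lt hℓ.pos one_pos)
      rw [natDegree_X_pow]
      exact Nat.le_sub_one_of_lt (Finset.mem_range.mp hi)
    have hdvd : (minpoly K ζ).natDegree ∣ ℓ :=
      minpoly.degree_dvd (Algebra.IsIntegral.isIntegral ζ)
    have h1 := ((Nat.dvd_prime hℓ).mp hdvd).resolve_right hlt.ne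
    obtain ⟨z, hz⟩ := minpoly.natDegree_eq_one_iff.mp h1
    refine ⟨z, (mem_primitiveRoots hℓ.pos).mpr ?_⟩
    rw [← hz] at hζ
    exact hζ.of_map_of_injective (algebraMap K C).injective
  have hcard : Nat.card Gal(C/K) = ℓ := IsGalois.card_aut_eq_finrank K C
  have : Fact ℓ.Prime := ⟨hℓ⟩
  have : IsCyclic Gal(C/K) := isCyclic_of_prime_card hcard
  obtain ⟨α, ⟨a, ha⟩, hα⟩ := exists_root_adjoin_eq_top_of_isCyclic K C hroot
  have hirr := irreducible_X_pow_sub_C_of_root_adjoin_eq_top ha.symm hα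
  have hpow : ∀ b : K, b ^ ℓ ≠ a :=
    pow_ne_of_irreducible_X_pow_sub_C hirr dvd_rfl hℓ.ne_one
  by_cases h2 : ℓ = 2
  · obtain ⟨σ, hσ⟩ : ∃ σ : Gal(C/K), ∀ τ, τ = 1 ∨ τ = σ := by
      obtain ⟨σ, τ, -, h⟩ := Nat.card_eq_two_iff.mp (hcard.trans h2)
      have h' : ∀ ρ : Gal(C/K), ρ = σ ∨ ρ = τ := fun ρ => by
        simpa using h.ge (Set.mem_univ ρ)
      rcases h' 1 with rfl | rfl
      exacts [⟨τ, h'⟩, ⟨σ, fun ρ => (h' ρ).symm⟩]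
    have hσ1 : σ ≠ 1 := by
      rintro rfl
      have : Subsingleton Gal(C/K) := ⟨fun x y => by
        rw [(or_self_iff.mp (hσ x)), (or_self_iff.mp (hσ y))]⟩
      have := Nat.card_of_subsingleton (1 : Gal(C/K))
      omega
    have hnorm : ∀ x : C, algebraMap K C (Algebra.norm K x) = x * σ x := by
      intro x
      classical
      have huniv : (Finset.univ : Finset Gal(C/K)) = {1, σ} := by
        ext τ; simpa using hσ τ
      rw [Algebra.norm_eq_prod_automorphisms, huniv, Finset.prod_pair hσ1.symm, AlgEquiv.one_apply]
    have hneg : ∀ x ∉ Set.range (algebraMap K C), ∀ c : K, x ^ 2 = algebraMap K C c →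
        σ x = - x := by
      intro x hx c hc
      have hsq : (σ x) ^ 2 = x ^ 2 := by rw [← map_pow, hc, AlgEquiv.commutes]
      refine (sq_eq_sq_iff_eq_or_eq_neg.mp hsq).resolve_left fun h => hx ?_
      rw [IsGalois.mem_range_algebraMap_iff_fixed]
      intro τ
      rcases hσ τ with rfl | rfl
      exacts [rfl, h]
    obtain ⟨β, hβ⟩ := IsAlgClosed.exists_pow_nat_eq α (n := 2) two_pos
    have hαK : α ∉ Set.range (algebraMap K C) := by
      rintro ⟨b, rfl⟩
      rw [← map_pow] at ha
      exact hpow b ((algebraMap K C).injective ha.symm)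
    have hα2 : α ^ 2 = algebraMap K C a := by rw [ha, ← hℓdef, h2]
    have hNα : Algebra.norm K β ^ 2 = - a := by
      apply (algebraMap K C).injective
      rw [← map_pow, hβ, hnorm, hneg α hαK a hα2, map_neg, ← hα2]; ring
    obtain ⟨c, hc⟩ : ∃ c : K, c ^ 2 = -1 := by
      obtain ⟨i, hi⟩ := IsAlgClosed.exists_pow_nat_eq (-1 : C) (n := 2) two_pos
      by_cases hiK : i ∈ Set.range (algebraMap K C)
      · obtain ⟨c, rfl⟩ := hiK
        exact ⟨c, (algebraMap K C).injective (by simpa using hi)⟩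
      obtain ⟨u, v, huv⟩ := ZMod.sq_add_sq p (-1)
      let φ := ZMod.castHom (dvd_refl p) K
      have huv' : φ u ^ 2 + φ v ^ 2 = -1 := by rw [← map_pow, ← map_pow, ← map_add, huv]; simp
      obtain ⟨s, hs⟩ := IsAlgClosed.exists_pow_nat_eq
        (algebraMap K C (φ u) + algebraMap K C (φ v) * i) (n := 2) two_pos
      refine ⟨Algebra.norm K s, ?_⟩
      apply (algebraMap K C).injective
      rw [← map_pow, hs, hnorm, map_add, map_mul, AlgEquiv.commutes, AlgEquiv.commutes,
        hneg i hiK (-1) (by simpa using hi), ← huv', map_add, map_pow, map_pow]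
      linear_combination (-(algebraMap K C (φ v)) ^ 2) * hi
    refine hpow (c * Algebra.norm K β) ?_
    rw [h2, mul_pow, hNα, hc]; ring
  · have hirr2 := X_pow_sub_C_irreducible_of_prime_pow hℓ h2 2 hpow
    obtain ⟨β, hβ⟩ := IsAlgClosed.exists_pow_nat_eq (algebraMap K C a) (n := ℓ ^ 2)
      (pow_pos hℓ.pos 2)
    have hmin := minpoly.eq_of_irreducible_of_monic hirr2 (x := β) (by simp [hβ])
      (monic_X_pow_sub_C _ (pow_pos hℓ.pos 2).ne')
    have := hdeg β
    rw [← hmin, natDegree_X_pow_sub_C] at this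
    nlinarith [hℓ.one_lt]

/-- In positive characteristic, a field whose algebraic closure is a finite Galois extension is
algebraically closed. -/
theorem isAlgClosed_of_isGalois {F C : Type u} [Field F] [Field C] [Algebra F C]
    [IsAlgClosed C] [FiniteDimensional F C] [IsGalois F C] {p : ℕ} [Fact p.Prime]
    [CharP F p] : IsAlgClosed F := by
  by_cases h1 : Nat.card Gal(C/F) = 1
  · rw [IsGalois.card_aut_eq_finrank] at h1
    have hbij : Function.Bijective (algebraMap F C) :=
      ⟨(algebraMap F C).injective, (Subalgebra.bot_eq_top_iff_finrank_eq_one.mpr h1).symm |>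
        Algebra.surjective_algebraMap_iff.mpr⟩
    exact IsAlgClosed.of_ringEquiv C F (RingEquiv.ofBijective _ hbij).symm
  · obtain ⟨ℓ, hℓ, hdvd⟩ := Nat.exists_prime_and_dvd h1
    have : Fact ℓ.Prime := ⟨hℓ⟩
    obtain ⟨H, hH⟩ := Sylow.exists_subgroup_card_pow_prime (G := Gal(C/F)) ℓ (n := 1)
      (by simpa using hdvd)
    have hfin : finrank (fixedField H) C = ℓ := by
      rw [finrank_fixedField_eq_card, hH, pow_one]
    have : CharP (fixedField H) p :=
      charP_of_injective_algebraMap (algebraMap F (fixedField H)).injective p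
    exact absurd (hfin ▸ hℓ) (finrank_not_prime_of_isAlgClosed (K := fixedField H) (p := p))

/-- If the degrees of algebraic elements over `F` are bounded then `F` is perfect. -/
theorem perfectField_of_natDegree_minpoly_lt {F C : Type*} [Field F] [Field C] [Algebra F C]
    [IsAlgClosed C] [Algebra.IsAlgebraic F C] {p : ℕ} [hp : Fact p.Prime] [CharP F p] {N : ℕ}
    (hN : ∀ x : C, (minpoly F x).natDegree < N) : PerfectField F := by
  have : CharP C p := charP_of_injective_algebraMap (algebraMap F C).injective p
  suffices PerfectRing F p from PerfectRing.toPerfectField F p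
  refine PerfectRing.ofSurjective F p fun a => ?_
  obtain ⟨x, hx⟩ := IsAlgClosed.exists_pow_nat_eq (algebraMap F C a) (n := p ^ (N + 1))
    (pow_pos hp.out.pos _)
  obtain ⟨k, y, hk⟩ := (minpoly.natSepDegree_eq_one_iff_eq_X_pow_sub_C (F := F) (x := x) p).mp
    ((minpoly.natSepDegree_eq_one_iff_pow_mem p).mpr ⟨N + 1, a, hx.symm⟩)
  have hkN : k ≤ N := by
    have := hN x
    rw [hk, natDegree_X_pow_sub_C] at this
    exact (Nat.lt_pow_self hp.out.one_lt).le.trans this.le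
  have hxy : x ^ p ^ k = algebraMap F C y := by
    have := minpoly.aeval F x
    rw [hk] at this
    simpa [sub_eq_zero] using this
  refine ⟨y ^ p ^ (N - k), (algebraMap F C).injective ?_⟩
  rw [frobenius_def, map_pow, map_pow, ← hxy, ← hx, ← pow_mul, ← pow_mul, ← pow_succ, ← pow_add]
  congr 2; omega

/-- A separable algebraic extension in which the degrees of elements are bounded is finite. -/
theorem finiteDimensional_of_natDegree_minpoly_lt {F C : Type*} [Field F] [Field C] [Algebra F C]
    [Algebra.IsSeparable F C] {N : ℕ}
    (hN : ∀ x : C, (minpoly F x).natDegree < N) : FiniteDimensional F C := by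
  have hbdd : BddAbove (Set.range fun x : C => (minpoly F x).natDegree) :=
    ⟨N, by rintro _ ⟨x, rfl⟩; exact (hN x).le⟩
  obtain ⟨θ, hθ⟩ := Nat.sSup_mem (Set.range_nonempty _) hbdd
  have hmax : ∀ x : C, (minpoly F x).natDegree ≤ (minpoly F θ).natDegree := fun x =>
    (le_csSup hbdd ⟨x, rfl⟩).trans_eq hθ.symm
  have hint : ∀ x : C, IsIntegral F x := fun x => Algebra.IsIntegral.isIntegral x
  have htop : F⟮θ⟯ = ⊤ := by
    refine eq_top_iff.mpr fun x _ => ?_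
    have : FiniteDimensional F F⟮θ, x⟯ := finiteDimensional_adjoin fun y _ => hint y
    obtain ⟨γ, hγ⟩ := Field.exists_primitive_element F F⟮θ, x⟯
    have hγ' : F⟮(γ : C)⟯ = F⟮θ, x⟯ := by
      have := congrArg (IntermediateField.map F⟮θ, x⟯.val) hγ
      simpa [adjoin_map, ← AlgHom.fieldRange_eq_map] using this
    have hle : F⟮θ⟯ ≤ F⟮θ, x⟯ := adjoin.mono _ _ _ (by simp)
    have heq : F⟮θ⟯ = F⟮θ, x⟯ := by
      refine eq_of_le_of_finrank_le hle ?_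
      rw [← hγ', adjoin.finrank (hint _), adjoin.finrank (hint _)]
      exact hmax _
    rw [heq]
    exact subset_adjoin _ _ (by simp)
  have : FiniteDimensional F F⟮θ⟯ := adjoin.finiteDimensional (hint θ)
  rw [htop] at this
  exact topEquiv.toLinearEquiv.finiteDimensional

/-- A field of positive characteristic which is not algebraically closed has algebraic elements
of arbitrarily large degree. -/
theorem exists_le_natDegree_minpoly {F : Type*} [Field F] {p : ℕ} [Fact p.Prime] [CharP F p]
    (hF : ¬ IsAlgClosed F) (N : ℕ) : ∃ θ : AlgebraicClosure F, N ≤ (minpoly F θ).natDegree := by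
  by_contra! hN
  have := perfectField_of_natDegree_minpoly_lt (p := p) hN
  have := finiteDimensional_of_natDegree_minpoly_lt hN
  exact hF (isAlgClosed_of_isGalois (C := AlgebraicClosure F) (p := p))

end AlgebraicClosure

/-- Kronecker substitution: at suitable powers of an algebraic element of large degree, no nonzero
polynomial of small total degree vanishes. -/
theorem MvPolynomial.exists_forall_aeval_ne_zero {F C : Type*} [Field F] [Field C] [Algebra F C]
    {n N : ℕ} {θ : C} (hθ : N ^ n ≤ (minpoly F θ).natDegree) :
    ∃ y : Fin n → C, ∀ P : MvPolynomial (Fin n) F, P ≠ 0 → P.totalDegree < N →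
      MvPolynomial.aeval y P ≠ 0 := by
  refine ⟨fun i => θ ^ N ^ (i : ℕ), fun P hP hdeg h0 => hP ?_⟩
  let e : (Fin n →₀ ℕ) → ℕ := fun m => ∑ i, m i * N ^ (i : ℕ)
  have hm : ∀ m ∈ P.support, ∀ i, m i < N := fun m hm i =>
    ((Finsupp.le_degree i m).trans (P.le_totalDegree hm)).trans_lt hdeg
  have he : ∀ m (h : ∀ i, m i < N), e m = (finFunctionFinEquiv fun i => ⟨m i, h i⟩ : Fin (N ^ n)) :=
    fun m h => by simp [e]
  have hinj : ∀ m ∈ P.support, ∀ m' ∈ P.support, e m = e m' → m = m' := by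
    intro m h m' h' hmm
    rw [he m (hm m h), he m' (hm m' h')] at hmm
    have := finFunctionFinEquiv.injective (Fin.ext hmm)
    ext i
    simpa using congrFun this i
  let Q : Polynomial F := ∑ m ∈ P.support, Polynomial.monomial (e m) (P.coeff m)
  have hQ : Polynomial.aeval θ Q = 0 := by
    rw [← h0, MvPolynomial.aeval_def, MvPolynomial.eval₂_eq', map_sum]
    refine Finset.sum_congr rfl fun m _ => ?_
    rw [Polynomial.aeval_monomial, ← Finset.prod_pow_eq_pow_sum]
    refine congrArg _ (Finset.prod_congr rfl fun i _ => ?_)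
    rw [← pow_mul, mul_comm]
  have hQ0 : Q = 0 := by
    by_contra hne
    have h1 := Polynomial.natDegree_le_of_dvd (minpoly.dvd F θ hQ) hne
    have h2 : Q.natDegree < N ^ n := by
      rw [Polynomial.natDegree_lt_iff_degree_lt hne]
      refine (Polynomial.degree_sum_le _ _).trans_lt ?_
      rw [Finset.sup_lt_iff (WithBot.bot_lt_coe _)]
      intro m h
      refine (Polynomial.degree_monomial_le _ _).trans_lt ?_
      rw [he m (hm m h)]
      exact_mod_cast Fin.is_lt _
    omega
  ext m
  by_cases h : m ∈ P.support
  · have := congrArg (Polynomial.coeff · (e m)) hQ0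
    simp only [Q, Polynomial.finsetSum_coeff, Polynomial.coeff_monomial] at this
    rwa [Finset.sum_eq_single_of_mem m h fun m' h' hne =>
      if_neg fun hh => hne (hinj m' h' m h hh), if_pos rfl] at this
  · rw [MvPolynomial.notMem_support_iff.mp h, MvPolynomial.coeff_zero]

section Representations

attribute [local instance] LieRing.ofAssociativeRing

/-- In a finite-dimensional space some term of a sequence is a combination of the previous ones. -/
theorem Module.exists_eq_sum_range_smul {F W : Type*} [Field F] [AddCommGroup W] [Module F W]
    [FiniteDimensional F W] (v : ℕ → W) :
    ∃ J ≤ Module.finrank F W, ∃ d : ℕ → F, v J = ∑ j ∈ Finset.range J, d j • v j := by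
  classical
  by_contra! h
  have key : ∀ k ≤ Module.finrank F W + 1, LinearIndependent F fun i : Fin k => v i := by
    intro k
    induction k with
    | zero => exact fun _ => linearIndependent_empty_type
    | succ k ih =>
      intro hk
      rw [linearIndependent_finSucc']
      refine ⟨ih (by omega), fun hmem => ?_⟩
      have hr : Set.range (Fin.init fun i : Fin (k + 1) => v i) =
          v '' (Finset.range k : Set ℕ) := by
        ext w
        constructor
        · rintro ⟨i, rfl⟩
          exact ⟨i, by simp, rfl⟩
        · rintro ⟨i, hi, rfl⟩
          exact ⟨⟨i, by simpa using hi⟩, rfl⟩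
      rw [hr, Submodule.mem_span_image_finset_iff_exists_fun] at hmem
      obtain ⟨d, hd⟩ := hmem
      refine h k (by omega) (fun j => if hj : j ∈ Finset.range k then d ⟨j, hj⟩ else 0) ?_
      rw [← Finset.sum_coe_sort]
      simpa using hd.symm
  have := (key _ le_rfl).fintype_card_le_finrank
  simp at this

theorem LieAlgebra.ad_pow_char_pow {F A : Type*} [Field F] [Ring A] [Algebra F A] [Nontrivial A]
    (p : ℕ) [Fact p.Prime] [CharP F p] (a : A) (k : ℕ) :
    LieAlgebra.ad F A (a ^ p ^ k) = LieAlgebra.ad F A a ^ p ^ k := by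
  have : CharP (Module.End F A) p :=
    charP_of_injective_algebraMap (algebraMap F (Module.End F A)).injective p
  have hc : Commute (LinearMap.mulLeft F a) (LinearMap.mulRight F a) :=
    LinearMap.commute_mulLeft_right a a
  have e := fun c : A => congrFun (LieAlgebra.ad_eq_lmul_left_sub_lmul_right (R := F) A) c
  rw [e, e]
  simp only [Pi.sub_apply]
  rw [sub_pow_char_pow_of_commute p k hc, LinearMap.pow_mulLeft, LinearMap.pow_mulRight]

namespace MvPolynomial

variable {F M ι : Type*} [Field F] [AddCommGroup M] [Module F M]

/-- The linear form attached to a vector, in the symmetric algebra on a based space. -/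
noncomputable def linForm (b : Module.Basis ι F M) : M →ₗ[F] MvPolynomial ι F :=
  b.constr F X

@[simp] theorem linForm_basis (b : Module.Basis ι F M) (i : ι) : linForm b (b i) = X i := by
  simp [linForm]

theorem linForm_eq_zero (b : Module.Basis ι F M) {m : M} (h : linForm b m = 0) : m = 0 := by
  rw [linForm, Module.Basis.constr_apply, Finsupp.sum] at h
  rw [← b.repr.map_eq_zero_iff]
  classical
  ext i
  have := congrArg (coeff (Finsupp.single i 1)) h
  simp only [coeff_sum, coeff_smul, coeff_X, Finsupp.single_left_inj one_ne_zero] at this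
  simpa using this

theorem isHomogeneous_linForm (b : Module.Basis ι F M) (m : M) : (linForm b m).IsHomogeneous 1 := by
  rw [linForm, Module.Basis.constr_apply, Finsupp.sum]
  refine IsHomogeneous.sum _ _ _ fun i _ => ?_
  rw [smul_eq_C_mul]
  exact (isHomogeneous_C_mul_X _ _)

/-- The derivation of the symmetric algebra extending an endomorphism. -/
noncomputable def linDer (b : Module.Basis ι F M) :
    Module.End F M →ₗ[F] Derivation F (MvPolynomial ι F) (MvPolynomial ι F) where
  toFun T := mkDerivation F fun i => linForm b (T (b i))
  map_add' S T := by
    refine derivation_ext fun i => ?_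
    simp [mkDerivation_X]
  map_smul' c T := by
    refine derivation_ext fun i => ?_
    simp [mkDerivation_X]

theorem linDer_linForm (b : Module.Basis ι F M) (T : Module.End F M) (m : M) :
    linDer b T (linForm b m) = linForm b (T m) := by
  have : (linDer b T).toLinearMap ∘ₗ linForm b = linForm b ∘ₗ T := by
    refine b.ext fun i => ?_
    simp [linDer, mkDerivation_X]
  exact LinearMap.congr_fun this m

theorem linDer_mem_restrictTotalDegree (b : Module.Basis ι F M) (T : Module.End F M) {k : ℕ}
    {g : MvPolynomial ι F} (hg : g ∈ restrictTotalDegree ι F k) :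
    linDer b T g ∈ restrictTotalDegree ι F k := by
  rw [mem_restrictTotalDegree] at hg
  rw [g.as_sum, map_sum]
  refine Submodule.sum_mem _ fun s hs => ?_
  have hs' := (le_totalDegree hs).trans hg
  rw [linDer, LinearMap.coe_mk, AddHom.coe_mk, mkDerivation_monomial]
  refine Submodule.smul_mem _ _ (Submodule.sum_mem _ fun i hi => ?_)
  rw [mem_restrictTotalDegree]
  refine (totalDegree_mul _ _).trans ?_
  have h1 := (isHomogeneous_linForm b (T (b i))).totalDegree_le
  have h2 := totalDegree_monomial_le (s - Finsupp.single i 1) (s i : F)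
  have h3 : (s - Finsupp.single i 1).degree + 1 = s.degree := by
    have : Finsupp.single i 1 ≤ s := by
      rw [Finsupp.single_le_iff]
      exact Nat.one_le_iff_ne_zero.2 (Finsupp.mem_support_iff.1 hi)
    conv_rhs => rw [← tsub_add_cancel_of_le this]
    simp [map_add]
  have h4 : (s - Finsupp.single i 1).degree = (s - Finsupp.single i 1).sum fun _ ↦ id := rfl
  have h5 : s.degree = s.sum fun _ e ↦ e := rfl
  omega

/-- `T ↦ T + T m` as a differential operator on the symmetric algebra: the action of
endomorphisms shifted by the vector `m`. -/
noncomputable def shiftRep (b : Module.Basis ι F M) (m : M) :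
    Module.End F M →ₗ⁅F⁆ Module.End F (MvPolynomial ι F) where
  toFun T := (linDer b T).toLinearMap + LinearMap.mulLeft F (linForm b (T m))
  map_add' S T := by
    refine LinearMap.ext fun g => ?_
    simp [add_mul, add_add_add_comm]
  map_smul' c T := by
    refine LinearMap.ext fun g => ?_
    simp
  map_lie' := by
    intro S T
    have h : linDer b ⁅S, T⁆ = ⁅linDer b S, linDer b T⁆ := by
      refine derivation_ext fun i => ?_
      rw [← linForm_basis b i]
      simp only [Derivation.commutator_apply, linDer_linForm, LieRing.of_associative_ring_bracket]
      simp
    refine LinearMap.ext fun g => ?_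
    have h' := DFunLike.congr_fun h g
    rw [Derivation.commutator_apply] at h'
    simp [LieRing.of_associative_ring_bracket] at h' ⊢
    simp [h', linDer_linForm]
    ring

theorem shiftRep_apply (b : Module.Basis ι F M) (m : M) (T : Module.End F M)
    (g : MvPolynomial ι F) : shiftRep b m T g = linDer b T g + linForm b (T m) * g := rfl

theorem shiftRep_lie_mulLeft (b : Module.Basis ι F M) (m v : M) (T : Module.End F M) :
    ⁅shiftRep b m T, LinearMap.mulLeft F (linForm b v)⁆ =
      LinearMap.mulLeft F (linForm b (T v)) := by
  refine LinearMap.ext fun g => ?_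
  simp only [LieRing.of_associative_ring_bracket, LinearMap.sub_apply, Module.End.mul_apply,
    LinearMap.mulLeft_apply, shiftRep_apply, Derivation.leibniz, smul_eq_mul, linDer_linForm]
  ring

theorem ad_shiftRep_pow_mulLeft (b : Module.Basis ι F M) (m v : M) (T : Module.End F M) (k : ℕ) :
    (LieAlgebra.ad F (Module.End F (MvPolynomial ι F)) (shiftRep b m T) ^ k)
      (LinearMap.mulLeft F (linForm b v)) = LinearMap.mulLeft F (linForm b ((T ^ k) v)) := by
  induction k with
  | zero => simp
  | succ k ih =>
    rw [pow_succ', Module.End.mul_apply, ih, LieAlgebra.ad_apply, shiftRep_lie_mulLeft, pow_succ',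
      Module.End.mul_apply]

theorem apply_eq_apply_one_mul (b : Module.Basis ι F M) (Ψ : Module.End F (MvPolynomial ι F))
    (h : ∀ v, ⁅Ψ, LinearMap.mulLeft F (linForm b v)⁆ = 0) (g : MvPolynomial ι F) :
    Ψ g = Ψ 1 * g := by
  induction g using MvPolynomial.induction_on with
  | C a => rw [← mul_one (C a), ← smul_eq_C_mul, map_smul, mul_smul_comm, mul_one]
  | add f g hf hg => rw [map_add, hf, hg, mul_add]
  | mul_X f i hf =>
    have := LinearMap.congr_fun (h (b i)) f
    simp only [LieRing.of_associative_ring_bracket, LinearMap.sub_apply, Module.End.mul_apply,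
      LinearMap.mulLeft_apply, linForm_basis, LinearMap.zero_apply, sub_eq_zero] at this
    rw [mul_comm f, this, hf]
    ring

theorem shiftRep_pow_one_sub_mem (b : Module.Basis ι F M) (m : M) (T : Module.End F M) (k : ℕ) :
    (shiftRep b m T ^ (k + 1)) 1 - linForm b (T m) ^ (k + 1) ∈ restrictTotalDegree ι F k := by
  have hf := (isHomogeneous_linForm b (T m)).totalDegree_le
  induction k with
  | zero => simp [shiftRep_apply]
  | succ k ih =>
    have h1 : (shiftRep b m T ^ (k + 1)) 1 ∈ restrictTotalDegree ι F (k + 1) := by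
      rw [← sub_add_cancel ((shiftRep b m T ^ (k + 1)) 1) (linForm b (T m) ^ (k + 1))]
      refine Submodule.add_mem _ ?_ ?_
      · rw [mem_restrictTotalDegree] at ih ⊢
        omega
      · rw [mem_restrictTotalDegree]
        exact (totalDegree_pow _ _).trans (by nlinarith)
    have h2 : linForm b (T m) * ((shiftRep b m T ^ (k + 1)) 1 - linForm b (T m) ^ (k + 1)) ∈
        restrictTotalDegree ι F (k + 1) := by
      rw [mem_restrictTotalDegree] at ih ⊢
      exact (totalDegree_mul _ _).trans (by omega)
    have := Submodule.add_mem _ (linDer_mem_restrictTotalDegree b T h1) h2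
    convert this using 1
    rw [pow_succ' (shiftRep b m T), Module.End.mul_apply, shiftRep_apply]
    ring

theorem exists_mul_mem_of_shiftRep_mem {p : ℕ} [Fact p.Prime] [CharP F p] [FiniteDimensional F M]
    (b : Module.Basis ι F M) (m : M) (T : Module.End F M) (hm : T m ≠ 0) :
    ∃ ψ : MvPolynomial ι F, ψ ≠ 0 ∧ ψ.totalDegree ≤ p ^ Module.finrank F (Module.End F M) ∧
      ∀ I : Submodule F (MvPolynomial ι F), (∀ g ∈ I, shiftRep b m T g ∈ I) →
        ∀ g, shiftRep b m T g ∈ I → ψ * g ∈ I := by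
  obtain ⟨J, hJ, d, hd⟩ := Module.exists_eq_sum_range_smul (F := F) fun j => T ^ p ^ j
  have hp : 0 < p := (Fact.out : p.Prime).pos
  set ρ := shiftRep b m T with hρ
  set Ψ : Module.End F (MvPolynomial ι F) := ρ ^ p ^ J - ∑ j ∈ Finset.range J, d j • ρ ^ p ^ j
    with hΨ
  have hcomm : ∀ v, ⁅Ψ, LinearMap.mulLeft F (linForm b v)⁆ = 0 := by
    intro v
    rw [← LieAlgebra.ad_apply F, hΨ]
    simp only [map_sub, map_sum, map_smul, LieAlgebra.ad_pow_char_pow p, LinearMap.sub_apply,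
      LinearMap.sum_apply, LinearMap.smul_apply]
    simp only [hρ, ad_shiftRep_pow_mulLeft]
    rw [hd]
    refine LinearMap.ext fun g => ?_
    simp [Finset.sum_mul]
  have hmul := apply_eq_apply_one_mul b Ψ hcomm
  have hpow : ∀ k, 0 < k → (ρ ^ k) 1 - linForm b (T m) ^ k ∈ restrictTotalDegree ι F (k - 1) := by
    intro k hk
    obtain ⟨k, rfl⟩ := Nat.exists_eq_succ_of_ne_zero hk.ne'
    exact shiftRep_pow_one_sub_mem b m T k
  have hf := (isHomogeneous_linForm b (T m)).totalDegree_le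
  have hlead : Ψ 1 - linForm b (T m) ^ p ^ J ∈ restrictTotalDegree ι F (p ^ J - 1) := by
    have : Ψ 1 - linForm b (T m) ^ p ^ J = ((ρ ^ p ^ J) 1 - linForm b (T m) ^ p ^ J) -
        ∑ j ∈ Finset.range J, d j •
          (((ρ ^ p ^ j) 1 - linForm b (T m) ^ p ^ j) + linForm b (T m) ^ p ^ j) := by
      simp only [hΨ, sub_add_cancel, LinearMap.sub_apply, LinearMap.sum_apply,
        LinearMap.smul_apply]
      ring
    rw [this]
    refine Submodule.sub_mem _ (hpow _ (by positivity)) (Submodule.sum_mem _ fun j hj => ?_)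
    have hlt : p ^ j < p ^ J :=
      Nat.pow_lt_pow_right (Fact.out : p.Prime).one_lt (Finset.mem_range.1 hj)
    refine Submodule.smul_mem _ _ (Submodule.add_mem _ ?_ ?_)
    · have := hpow (p ^ j) (by positivity)
      rw [mem_restrictTotalDegree] at this ⊢
      omega
    · rw [mem_restrictTotalDegree]
      exact (totalDegree_pow _ _).trans
        (by nlinarith [Nat.sub_add_cancel (show 1 ≤ p ^ J by omega)])
  rw [mem_restrictTotalDegree] at hlead
  have hq : 0 < p ^ J := by positivity
  have hne : linForm b (T m) ^ p ^ J ≠ 0 := pow_ne_zero _ fun h => hm (linForm_eq_zero b h)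
  refine ⟨Ψ 1, fun h0 => ?_, ?_, fun I hI g hg => ?_⟩
  · rw [h0, zero_sub, totalDegree_neg,
      ((isHomogeneous_linForm b (T m)).pow _).totalDegree hne] at hlead
    omega
  · rw [← sub_add_cancel (Ψ 1) (linForm b (T m) ^ p ^ J)]
    have h1 : (linForm b (T m) ^ p ^ J).totalDegree ≤ p ^ J :=
      (totalDegree_pow _ _).trans (by nlinarith)
    have h2 : p ^ J ≤ p ^ Module.finrank F (Module.End F M) := Nat.pow_le_pow_right hp hJ
    exact (totalDegree_add _ _).trans (by omega)
  · rw [← hmul]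
    have key : ∀ k, 0 < k → (ρ ^ k) g ∈ I := by
      intro k hk
      obtain ⟨k, rfl⟩ := Nat.exists_eq_succ_of_ne_zero hk.ne'
      induction k with
      | zero => simpa using hg
      | succ k ih =>
        rw [pow_succ', Module.End.mul_apply]
        exact hI _ (ih (by omega))
    simp only [hΨ, LinearMap.sub_apply, LinearMap.sum_apply, LinearMap.smul_apply]
    exact Submodule.sub_mem _ (key _ hq)
      (Submodule.sum_mem _ fun j _ => Submodule.smul_mem _ _ (key _ (by positivity)))

end MvPolynomial

/-- Shifted symmetric powers: over a field of positive characteristic which is not algebraically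
closed, `gl M` has a finite-dimensional representation in which every endomorphism not killing
`m` acts injectively. -/
theorem Module.End.exists_rep_injective {F M : Type} [Field F] {p : ℕ} [Fact p.Prime] [CharP F p]
    (hF : ¬ IsAlgClosed F) [AddCommGroup M] [Module F M] [FiniteDimensional F M] (m : M) :
    ∃ (V : Type) (_ : AddCommGroup V) (_ : Module F V) (_ : FiniteDimensional F V)
      (_ : Nontrivial V) (ρ : Module.End F M →ₗ⁅F⁆ Module.End F V),
      ∀ T, T m ≠ 0 → Function.Injective (ρ T) := by
  let n := Module.finrank F M
  let b : Module.Basis (Fin n) F M := Module.finBasis F M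
  let N := p ^ Module.finrank F (Module.End F M) + 1
  obtain ⟨θ, hθ⟩ := exists_le_natDegree_minpoly (p := p) hF (N ^ n)
  obtain ⟨y, hy⟩ := MvPolynomial.exists_forall_aeval_ne_zero hθ
  have hp : p ≠ 0 := (Fact.out : p.Prime).ne_zero
  let 𝔪 : Ideal (MvPolynomial (Fin n) F) := RingHom.ker (MvPolynomial.aeval (R := F) y)
  let I : Ideal (MvPolynomial (Fin n) F) := Ideal.span ((fun h => h ^ p) '' (𝔪 : Set _))
  have hpow : ∀ h ∈ 𝔪, h ^ p ∈ I := fun h hh => Ideal.subset_span ⟨h, hh, rfl⟩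
  have hle : I ≤ 𝔪 := by
    rw [Ideal.span_le]
    rintro _ ⟨h, hh, rfl⟩
    exact Ideal.pow_mem_of_mem _ hh _ (Nat.pos_of_ne_zero hp)
  have hder : ∀ T, ∀ g ∈ I, MvPolynomial.linDer b T g ∈ I := by
    intro T g hg
    induction hg using Submodule.span_induction with
    | mem g hg =>
      obtain ⟨h, -, rfl⟩ := hg
      simp [Derivation.leibniz_pow]
    | zero => simp
    | add f g _ _ hf hg => rw [map_add]; exact I.add_mem hf hg
    | smul a g hg h =>
      rw [smul_eq_mul, Derivation.leibniz]
      exact I.add_mem (I.mul_mem_left _ h) (I.mul_mem_right _ hg)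
  have hstab : ∀ T, ∀ g ∈ I, MvPolynomial.shiftRep b m T g ∈ I := fun T g hg => by
    rw [MvPolynomial.shiftRep_apply]
    exact I.add_mem (hder T g hg) (I.mul_mem_left _ hg)
  let I' : Submodule F (MvPolynomial (Fin n) F) := I.restrictScalars F
  have hfin : Module.Finite F (MvPolynomial (Fin n) F ⧸ I) := by
    have : Algebra.IsIntegral F (MvPolynomial (Fin n) F ⧸ I) := by
      refine ⟨fun g => ?_⟩
      obtain ⟨g, rfl⟩ := Ideal.Quotient.mkₐ_surjective F I g
      induction g using MvPolynomial.induction_on with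
      | C a =>
        rw [← MvPolynomial.algebraMap_eq, AlgHom.commutes]
        exact isIntegral_algebraMap
      | add f g hf hg => rw [map_add]; exact hf.add hg
      | mul_X f i hf =>
        rw [map_mul]
        refine hf.mul ⟨minpoly F (y i) ^ p,
          (minpoly.monic (Algebra.IsIntegral.isIntegral _)).pow _, ?_⟩
        rw [← Polynomial.aeval_def, map_pow, Polynomial.aeval_algHom_apply, ← map_pow]
        refine Ideal.Quotient.eq_zero_iff_mem.2 (hpow _ ?_)
        rw [RingHom.mem_ker, ← Polynomial.aeval_algHom_apply, MvPolynomial.aeval_X, minpoly.aeval]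
    exact Algebra.IsIntegral.finite
  have hfin' : FiniteDimensional F (MvPolynomial (Fin n) F ⧸ I') :=
    Module.Finite.equiv (Submodule.Quotient.restrictScalarsEquiv F I).symm
  have hnt : Nontrivial (MvPolynomial (Fin n) F ⧸ I') := by
    refine Submodule.Quotient.nontrivial_iff.2 fun h => ?_
    have h1 : (1 : MvPolynomial (Fin n) F) ∈ I' := h ▸ Submodule.mem_top
    have h2 := hle h1
    rw [RingHom.mem_ker, map_one] at h2
    exact one_ne_zero h2
  refine ⟨MvPolynomial (Fin n) F ⧸ I', inferInstance, inferInstance, hfin', hnt,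
    { toFun := fun T => I'.mapQ I' (MvPolynomial.shiftRep b m T) (hstab T)
      map_add' := fun S T => ?_
      map_smul' := fun c T => ?_
      map_lie' := fun {S T} => ?_ }, fun T hT => ?_⟩
  · refine Submodule.linearMap_qext _ (LinearMap.ext fun g => ?_)
    simp
    rfl
  · refine Submodule.linearMap_qext _ (LinearMap.ext fun g => ?_)
    simp
    rfl
  · refine Submodule.linearMap_qext _ (LinearMap.ext fun g => ?_)
    have h : MvPolynomial.shiftRep b m ⁅S, T⁆ g =
        MvPolynomial.shiftRep b m S (MvPolynomial.shiftRep b m T g) -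
          MvPolynomial.shiftRep b m T (MvPolynomial.shiftRep b m S g) := by
      rw [LieHom.map_lie]
      rfl
    exact (congrArg I'.mkQ h).trans (map_sub I'.mkQ _ _)
  · obtain ⟨ψ, hψ0, hψd, hψ⟩ := MvPolynomial.exists_mul_mem_of_shiftRep_mem (p := p) b m T hT
    have hψy := hy ψ hψ0 (Nat.lt_succ_of_le hψd)
    obtain ⟨ψ', hψ'⟩ : ∃ ψ', ψ * ψ' - 1 ∈ 𝔪 := by
      have hint : IsIntegral F (MvPolynomial.aeval y ψ) := Algebra.IsIntegral.isIntegral _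
      have := hint.inv_mem_adjoin
      rw [Algebra.adjoin_singleton_eq_range_aeval] at this
      obtain ⟨q, hq : Polynomial.aeval _ q = _⟩ := this
      refine ⟨Polynomial.aeval ψ q, ?_⟩
      rw [RingHom.mem_ker, map_sub, map_mul, ← Polynomial.aeval_algHom_apply, map_one, hq,
        mul_inv_cancel₀ hψy, sub_self]
    rw [injective_iff_map_eq_zero]
    intro v hv
    obtain ⟨g, rfl⟩ := I'.mkQ_surjective v
    have hg : MvPolynomial.shiftRep b m T g ∈ I' := (Submodule.Quotient.mk_eq_zero _).1 hv
    have h1 : ψ * g ∈ I := hψ I' (hstab T) g hg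
    refine (Submodule.Quotient.mk_eq_zero _).2 ?_
    have h2 := hpow _ hψ'
    rw [sub_pow_char, one_pow, mul_pow] at h2
    have h3 : g = ψ ^ (p - 1) * ψ' ^ p * (ψ * g) - (ψ ^ p * ψ' ^ p - 1) * g := by
      rw [← pow_sub_one_mul hp ψ]
      ring
    rw [h3]
    exact I.sub_mem (I.mul_mem_left _ h1) (I.mul_mem_right _ h2)

namespace LieAlgebra

variable {F L : Type*} [Field F] [LieRing L] [LieAlgebra F L] {n : ℕ}

/-- A weight on words which decreases when a descent is swapped. -/
def wordWeight : List (Fin n) → ℕ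
  | [] => 0
  | a :: w => a * w.length + wordWeight w

theorem wordWeight_swap_lt (u v : List (Fin n)) {i j : Fin n} (h : j < i) :
    wordWeight (u ++ j :: i :: v) < wordWeight (u ++ i :: j :: v) := by
  induction u with
  | nil =>
    have : (j : ℕ) < i := h
    simp only [List.nil_append, wordWeight, List.length_cons]
    nlinarith
  | cons a u ih =>
    simp only [List.cons_append, wordWeight, List.length_append, List.length_cons]
    omega

/-- The word `w` is `u i j v` with `j < i`. -/
def IsDescent (w : List (Fin n)) (d : List (Fin n) × Fin n × Fin n × List (Fin n)) : Prop :=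
  w = d.1 ++ d.2.1 :: d.2.2.1 :: d.2.2.2 ∧ d.2.2.1 < d.2.1

open Classical in
/-- Straightening of words in a basis, projected to the degree one part. -/
noncomputable def straighten (b : Module.Basis (Fin n) F L) (w : List (Fin n)) : L :=
  if h : ∃ d, IsDescent w d then
    straighten b (h.choose.1 ++ h.choose.2.2.1 :: h.choose.2.1 :: h.choose.2.2.2) +
      ∑ k, b.repr ⁅b h.choose.2.1, b h.choose.2.2.1⁆ k •
        straighten b (h.choose.1 ++ k :: h.choose.2.2.2)
  else if h : ∃ i, w = [i] then b h.choose else 0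
termination_by (w.length, wordWeight w)
decreasing_by
  · have h1 := h.choose_spec.1
    have h2 := h.choose_spec.2
    have hl : (h.choose.1 ++ h.choose.2.2.1 :: h.choose.2.1 :: h.choose.2.2.2).length =
        w.length := by
      conv_rhs => rw [h1]
      simp
    rw [hl]
    refine Prod.Lex.right _ ?_
    conv_rhs => rw [h1]
    exact wordWeight_swap_lt _ _ h2
  · have h1 := h.choose_spec.1
    refine Prod.Lex.left _ _ ?_
    conv_rhs => rw [h1]
    simp

theorem straighten_singleton (b : Module.Basis (Fin n) F L) (i : Fin n) :
    straighten b [i] = b i := by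
  have h : ¬ ∃ d, IsDescent [i] d := by
    rintro ⟨d, h, -⟩
    have := congrArg List.length h
    simp at this
    omega
  have h' : ∃ j, [i] = [j] := ⟨i, rfl⟩
  rw [straighten, dif_neg h, dif_pos h']
  exact congrArg b (List.cons.inj h'.choose_spec).1.symm

/-- Insertion of an element of the Lie algebra between two words. -/
noncomputable def insertWord {V : Type*} [AddCommGroup V] [Module F V]
    (b : Module.Basis (Fin n) F L) (s : List (Fin n) → V)
    (u v : List (Fin n)) : L →ₗ[F] V :=
  b.constr F fun k => s (u ++ k :: v)

theorem insertWord_basis {V : Type*} [AddCommGroup V] [Module F V]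
    (b : Module.Basis (Fin n) F L) (s : List (Fin n) → V) (u v : List (Fin n)) (k : Fin n) :
    insertWord b s u v (b k) = s (u ++ k :: v) := by
  simp [insertWord]

theorem exists_straighten_eq (b : Module.Basis (Fin n) F L) {w : List (Fin n)}
    (h : ∃ d, IsDescent w d) : ∃ u i j v, w = u ++ i :: j :: v ∧ j < i ∧
      straighten b w = straighten b (u ++ j :: i :: v) +
        insertWord b (straighten b) u v ⁅b i, b j⁆ := by
  refine ⟨_, _, _, _, h.choose_spec.1, h.choose_spec.2, ?_⟩
  rw [straighten, dif_pos h, insertWord, Module.Basis.constr_apply_fintype]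
  simp

/-- The commutation relation of the enveloping algebra at a given place of a word. -/
def SwapRel {V : Type*} [AddCommGroup V] [Module F V]
    (b : Module.Basis (Fin n) F L) (s : List (Fin n) → V) (u : List (Fin n)) (i j : Fin n)
    (v : List (Fin n)) : Prop :=
  s (u ++ i :: j :: v) = s (u ++ j :: i :: v) + insertWord b s u v ⁅b i, b j⁆

section Confluence

variable {V : Type*} [AddCommGroup V] [Module F V] {b : Module.Basis (Fin n) F L}
  {s : List (Fin n) → V}

theorem SwapRel.of_lt {u v : List (Fin n)}
    (h : ∀ i j, j < i → SwapRel b s u i j v) (i j : Fin n) : SwapRel b s u i j v := by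
  rcases lt_trichotomy i j with hij | rfl | hij
  · have := h j i hij
    rw [SwapRel, ← lie_skew, map_neg] at this
    rw [SwapRel, this]
    abel
  · rw [SwapRel, lie_self, map_zero, add_zero]
  · exact h i j hij

theorem insertWord_cons_sub {u v : List (Fin n)} (k : Fin n)
    (h : ∀ i j, SwapRel b s u i j v) (y : L) :
    insertWord b s u (k :: v) y = insertWord b s (u ++ [k]) v y + insertWord b s u v ⁅y, b k⁆ := by
  have : insertWord b s u (k :: v) = insertWord b s (u ++ [k]) v +
      insertWord b s u v ∘ₗ (-(LieAlgebra.ad F L (b k) : L →ₗ[F] L)) := by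
    refine b.ext fun i => ?_
    simp only [LinearMap.add_apply, LinearMap.comp_apply, LinearMap.neg_apply, ad_apply, lie_skew,
      insertWord_basis, List.append_assoc, List.singleton_append]
    exact h i k
  simp only [this, LinearMap.add_apply, LinearMap.comp_apply, LinearMap.neg_apply, ad_apply,
    lie_skew]

theorem insertWord_comm (u v t : List (Fin n)) (y z : L) :
    b.constr F (fun k => insertWord b s (u ++ k :: v) t z) y =
      b.constr F (fun l => insertWord b s u (v ++ l :: t) y) z := by
  simp only [insertWord, Module.Basis.constr_apply_fintype, Finset.smul_sum]
  rw [Finset.sum_comm]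
  refine Finset.sum_congr rfl fun i _ => Finset.sum_congr rfl fun j _ => ?_
  rw [smul_comm]
  simp

theorem confluent_disjoint {u v t : List (Fin n)} {i j k l : Fin n}
    (h₁ : SwapRel b s (u ++ j :: i :: v) k l t)
    (h₂ : SwapRel b s u i j (v ++ l :: k :: t))
    (h₃ : ∀ m, SwapRel b s (u ++ m :: v) k l t)
    (h₄ : ∀ m, SwapRel b s u i j (v ++ m :: t)) :
    s (u ++ j :: i :: (v ++ k :: l :: t)) + insertWord b s u (v ++ k :: l :: t) ⁅b i, b j⁆ =
      s ((u ++ i :: j :: v) ++ l :: k :: t) + insertWord b s (u ++ i :: j :: v) t ⁅b k, b l⁆ := by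
  have e₁ : insertWord b s u (v ++ k :: l :: t) ⁅b i, b j⁆ =
      insertWord b s u (v ++ l :: k :: t) ⁅b i, b j⁆ +
        b.constr F (fun m => insertWord b s (u ++ m :: v) t ⁅b k, b l⁆) ⁅b i, b j⁆ := by
    rw [← LinearMap.add_apply]
    congr 1
    refine b.ext fun m => ?_
    simpa [insertWord_basis, SwapRel] using h₃ m
  have e₂ : insertWord b s (u ++ i :: j :: v) t ⁅b k, b l⁆ =
      insertWord b s (u ++ j :: i :: v) t ⁅b k, b l⁆ +
        b.constr F (fun m => insertWord b s u (v ++ m :: t) ⁅b i, b j⁆) ⁅b k, b l⁆ := by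
    rw [← LinearMap.add_apply]
    congr 1
    refine b.ext fun m => ?_
    simpa [insertWord_basis, SwapRel] using h₄ m
  rw [e₁, e₂, insertWord_comm]
  simp only [SwapRel, List.append_assoc, List.cons_append] at h₁ h₂ ⊢
  rw [h₁, h₂]
  abel

theorem confluent_overlap {u v : List (Fin n)} {i j k : Fin n}
    (h₁ : SwapRel b s (u ++ [j]) i k v) (h₂ : SwapRel b s u j k (i :: v))
    (h₃ : SwapRel b s u i k (j :: v)) (h₄ : SwapRel b s (u ++ [k]) i j v)
    (h : ∀ i j, SwapRel b s u i j v) :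
    s (u ++ j :: i :: k :: v) + insertWord b s u (k :: v) ⁅b i, b j⁆ =
      s ((u ++ [i]) ++ k :: j :: v) + insertWord b s (u ++ [i]) v ⁅b j, b k⁆ := by
  simp only [SwapRel, List.append_assoc, List.cons_append, List.nil_append] at h₁ h₂ h₃ h₄ ⊢
  rw [h₁, h₂, h₃, h₄, insertWord_cons_sub i h, insertWord_cons_sub j h, insertWord_cons_sub k h]
  have hJ : ⁅⁅b i, b j⁆, b k⁆ = ⁅⁅b i, b k⁆, b j⁆ - ⁅⁅b j, b k⁆, b i⁆ := by
    have h₅ := lie_jacobi (b i) (b j) (b k)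
    have h₆ : ⁅⁅b i, b k⁆, b j⁆ = ⁅b j, ⁅b k, b i⁆⁆ := by
      rw [← lie_skew, ← lie_skew (b i) (b k), lie_neg, neg_neg]
    rw [h₆, ← lie_skew ⁅b i, b j⁆ (b k), ← lie_skew ⁅b j, b k⁆ (b i), neg_eq_iff_add_eq_zero, ← h₅]
    abel
  rw [hJ, map_sub]
  abel

theorem confluent {N W : ℕ}
    (hN : ∀ u i j v, (u ++ i :: j :: v).length < N → SwapRel b s u i j v)
    (hW : ∀ u i j v, (u ++ i :: j :: v).length = N → wordWeight (u ++ i :: j :: v) < W → j < i →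
      SwapRel b s u i j v)
    {u r v v' : List (Fin n)} {i j i' j' : Fin n}
    (hw : u ++ i :: j :: v = (u ++ r) ++ i' :: j' :: v')
    (hl : (u ++ i :: j :: v).length = N) (hwt : wordWeight (u ++ i :: j :: v) = W) (hij : j < i)
    (hij' : j' < i') :
    s (u ++ j :: i :: v) + insertWord b s u v ⁅b i, b j⁆ =
      s ((u ++ r) ++ j' :: i' :: v') + insertWord b s (u ++ r) v' ⁅b i', b j'⁆ := by
  have hw' := hw
  rw [List.append_assoc, List.append_cancel_left_eq] at hw'
  match r, hw' with
  | [], hw' =>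
    simp only [List.nil_append, List.cons.injEq] at hw'
    obtain ⟨rfl, rfl, rfl⟩ := hw'
    simp
  | [_], hw' =>
    simp only [List.cons_append, List.nil_append, List.cons.injEq] at hw'
    obtain ⟨rfl, rfl, rfl⟩ := hw'
    have w₁ := wordWeight_swap_lt u (j' :: v') hij
    have w₂ := wordWeight_swap_lt (u ++ [j]) v' (hij'.trans hij)
    have w₃ := wordWeight_swap_lt (u ++ [i]) v' hij'
    have w₄ := wordWeight_swap_lt u (j :: v') (hij'.trans hij)
    simp only [List.append_assoc, List.cons_append, List.nil_append] at w₁ w₂ w₃ w₄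
    refine confluent_overlap (hW _ _ _ _ ?_ ?_ (hij'.trans hij)) (hW _ _ _ _ ?_ ?_ hij')
      (hW _ _ _ _ ?_ ?_ (hij'.trans hij)) (hW _ _ _ _ ?_ ?_ hij) (fun _ _ => hN _ _ _ _ ?_)
    all_goals simp only [List.append_assoc, List.cons_append, List.nil_append, List.length_append,
      List.length_cons] at hl hwt ⊢
    all_goals omega
  | _ :: _ :: r, hw' =>
    simp only [List.cons_append, List.cons.injEq] at hw'
    obtain ⟨rfl, rfl, rfl⟩ := hw'
    have w₁ := wordWeight_swap_lt u (r ++ i' :: j' :: v') hij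
    have w₂ := wordWeight_swap_lt (u ++ i :: j :: r) v' hij'
    simp only [List.append_assoc, List.cons_append] at w₁ w₂
    refine confluent_disjoint (hW _ _ _ _ ?_ ?_ hij') (hW _ _ _ _ ?_ ?_ hij)
      (fun _ => hN _ _ _ _ ?_) (fun _ => hN _ _ _ _ ?_)
    all_goals simp only [List.append_assoc, List.cons_append, List.length_append,
      List.length_cons] at hl hwt ⊢
    all_goals omega

end Confluence

theorem swapRel_straighten (b : Module.Basis (Fin n) F L) (u : List (Fin n)) (i j : Fin n)
    (v : List (Fin n)) : SwapRel b (straighten b) u i j v := by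
  generalize hN : (u ++ i :: j :: v).length = N
  induction N using Nat.strong_induction_on generalizing u i j v with
  | _ N ihN =>
  refine SwapRel.of_lt (s := straighten b) (u := u) (v := v) (fun i j hij => ?_) i j
  replace hN : (u ++ i :: j :: v).length = N := by simpa using hN
  generalize hW : wordWeight (u ++ i :: j :: v) = W
  induction W using Nat.strong_induction_on generalizing u i j v with
  | _ W ihW =>
  have h₁ : ∀ u i j v, (u ++ i :: j :: v).length < N → SwapRel b (straighten b) u i j v :=
    fun u i j v h => ihN _ h u i j v rfl
  have h₂ : ∀ u i j v, (u ++ i :: j :: v).length = N → wordWeight (u ++ i :: j :: v) < W → j < i →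
      SwapRel b (straighten b) u i j v := fun u i j v h h' hij => ihW _ h' u v i j hij h rfl
  obtain ⟨u', i', j', v', hw, hij', hs⟩ := exists_straighten_eq b ⟨(u, i, j, v), rfl, hij⟩
  change u ++ i :: j :: v = _ at hw
  change straighten b (u ++ i :: j :: v) = _ at hs
  rw [SwapRel, hs]
  rcases List.append_eq_append_iff.1 hw with ⟨r, rfl, -⟩ | ⟨r, rfl, -⟩
  · exact (confluent h₁ h₂ hw hN hW hij hij').symm
  · exact confluent h₁ h₂ hw.symm (hw ▸ hN) (hw ▸ hW) hij' hij

/-- Functions on words compatible with the commutation relations. -/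
def swapFunctions (b : Module.Basis (Fin n) F L) : Submodule F (List (Fin n) → L) where
  carrier := {f | ∀ u i j v, SwapRel b f u i j v}
  zero_mem' u i j v := by simp [SwapRel, insertWord, Module.Basis.constr_apply_fintype]
  add_mem' {f g} hf hg u i j v := by
    have h₁ := hf u i j v
    have h₂ := hg u i j v
    simp only [SwapRel, insertWord, Module.Basis.constr_apply_fintype, Pi.add_apply, smul_add,
      Finset.sum_add_distrib] at h₁ h₂ ⊢
    rw [h₁, h₂]
    abel
  smul_mem' c f hf u i j v := by
    have h₁ := hf u i j v
    simp only [SwapRel, insertWord, Module.Basis.constr_apply_fintype, Pi.smul_apply,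
      smul_comm _ c, ← Finset.smul_sum] at h₁ ⊢
    rw [h₁, smul_add]

/-- Right translation by letters. -/
noncomputable def translate (b : Module.Basis (Fin n) F L) :
    L →ₗ[F] Module.End F (List (Fin n) → L) :=
  b.constr F fun k => LinearMap.funLeft F L fun w => w ++ [k]

theorem translate_basis (b : Module.Basis (Fin n) F L) (k : Fin n) (f : List (Fin n) → L)
    (w : List (Fin n)) : translate b (b k) f w = f (w ++ [k]) := by
  simp [translate, LinearMap.funLeft_apply]

theorem translate_apply (b : Module.Basis (Fin n) F L) (y : L) (f : List (Fin n) → L)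
    (w : List (Fin n)) : translate b y f w = insertWord b f w [] y := by
  simp [translate, insertWord, Module.Basis.constr_apply_fintype, LinearMap.funLeft_apply]

theorem translate_mem_swapFunctions (b : Module.Basis (Fin n) F L) (y : L)
    {f : List (Fin n) → L} (hf : f ∈ swapFunctions b) : translate b y f ∈ swapFunctions b := by
  have h : swapFunctions b ≤ (swapFunctions b).comap (translate b y) := by
    rw [translate, Module.Basis.constr_apply_fintype]
    intro f hf
    rw [Submodule.mem_comap, LinearMap.sum_apply]
    refine Submodule.sum_mem _ fun k _ => ?_
    rw [LinearMap.smul_apply]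
    refine Submodule.smul_mem _ _ fun u i j v => ?_
    have := hf u i j (v ++ [k])
    simpa [SwapRel, insertWord, LinearMap.funLeft_apply] using this
  exact h hf

/-- A faithful action of a finite-dimensional Lie algebra by associative operators. -/
noncomputable def swapRep (b : Module.Basis (Fin n) F L) :
    L →ₗ⁅F⁆ Module.End F (swapFunctions b) where
  toFun y := (translate b y).restrict fun _ => translate_mem_swapFunctions b y
  map_add' y z := LinearMap.ext fun f => Subtype.ext (by simp)
  map_smul' c y := LinearMap.ext fun f => Subtype.ext (by simp)
  map_lie' {y z} := by
    refine LinearMap.ext fun f => Subtype.ext ?_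
    obtain ⟨f, hf⟩ := f
    change translate b ⁅y, z⁆ f = translate b y (translate b z f) - translate b z (translate b y f)
    let ev : Module.End F (List (Fin n) → L) →ₗ[F] (List (Fin n) → L) := LinearMap.applyₗ f
    let B : L →ₗ[F] L →ₗ[F] (List (Fin n) → L) :=
      (LinearMap.mul F _).compl₁₂ (translate b) (translate b) |>.compr₂ ev
    have h : (LieModule.toEnd F L L : L →ₗ[F] Module.End F L).compr₂ (ev ∘ₗ translate b) =
        B - B.flip := by
      refine b.ext fun i => b.ext fun j => funext fun w => ?_
      have := hf w i j []
      simp only [SwapRel] at this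
      simp [ev, B, translate_basis, translate_apply b ⁅b i, b j⁆, this]
    exact LinearMap.congr_fun (LinearMap.congr_fun h y) z

theorem swapRep_injective (b : Module.Basis (Fin n) F L) : Function.Injective (swapRep b) := by
  rw [injective_iff_map_eq_zero]
  intro y hy
  have h := congrFun (congrArg Subtype.val (LinearMap.congr_fun hy
    ⟨straighten b, swapRel_straighten b⟩)) []
  change translate b y (straighten b) [] = 0 at h
  have h' : insertWord b (straighten b) [] [] = LinearMap.id :=
    b.ext fun k => by simp [insertWord_basis, straighten_singleton]
  rwa [translate_apply, h'] at h

end LieAlgebra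

/-- The canonical map from a finite-dimensional Lie algebra to its enveloping algebra is
injective. -/
theorem UniversalEnvelopingAlgebra.ι_injective (F L : Type*) [Field F] [LieRing L]
    [LieAlgebra F L] [FiniteDimensional F L] :
    Function.Injective (UniversalEnvelopingAlgebra.ι F : L → UniversalEnvelopingAlgebra F L) := by
  have h := LieAlgebra.swapRep_injective (Module.finBasis F L)
  rw [← UniversalEnvelopingAlgebra.ι_comp_lift F (LieAlgebra.swapRep (Module.finBasis F L))] at h
  exact h.of_comp

namespace LieHom

variable {F L A : Type*} [Field F] [LieRing L] [LieAlgebra F L] [Ring A] [Algebra F A]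

theorem exists_central_sub_pow {p : ℕ} [Fact p.Prime] [CharP F p] [FiniteDimensional F L]
    [Nontrivial A] (j : L →ₗ⁅F⁆ A) (hj : Algebra.adjoin F (Set.range j) = ⊤) (x : L) :
    ∃ (J : ℕ) (d : ℕ → F) (z : A), z ∈ Subalgebra.center F A ∧
      j x ^ p ^ J = z + ∑ k ∈ Finset.range J, d k • j x ^ p ^ k := by
  obtain ⟨J, -, d, hd⟩ := Module.exists_eq_sum_range_smul (F := F)
    fun k => (LieAlgebra.ad F L x : Module.End F L) ^ p ^ k
  refine ⟨J, d, j x ^ p ^ J - ∑ k ∈ Finset.range J, d k • j x ^ p ^ k, ?_, by simp⟩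
  set z := j x ^ p ^ J - ∑ k ∈ Finset.range J, d k • j x ^ p ^ k with hz
  have hpow : ∀ k y, (LieAlgebra.ad F A (j x) ^ k) (j y) = j ((LieAlgebra.ad F L x ^ k) y) := by
    intro k y
    induction k with
    | zero => simp
    | succ k ih =>
      rw [pow_succ', Module.End.mul_apply, ih, pow_succ', Module.End.mul_apply,
        LieAlgebra.ad_apply, LieAlgebra.ad_apply, LieHom.map_lie]
  have hcomm : ∀ y, ⁅z, j y⁆ = 0 := by
    intro y
    rw [← LieAlgebra.ad_apply F, hz]
    simp only [map_sub, map_sum, map_smul, LieAlgebra.ad_pow_char_pow p, LinearMap.sub_apply,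
      LinearMap.sum_apply, LinearMap.smul_apply, hpow]
    rw [hd]
    simp
  rw [Subalgebra.mem_center_iff]
  intro a
  have ha : a ∈ Algebra.adjoin F (Set.range j) := hj ▸ Algebra.mem_top
  induction ha using Algebra.adjoin_induction with
  | mem a ha =>
    obtain ⟨y, rfl⟩ := ha
    have := hcomm y
    rw [LieRing.of_associative_ring_bracket, sub_eq_zero] at this
    exact this.symm
  | algebraMap r => exact Algebra.commutes r z
  | add a c _ _ ha hc => rw [add_mul, mul_add, ha, hc]
  | mul a c _ _ ha hc => rw [mul_assoc, hc, ← mul_assoc, ha, mul_assoc]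

section Words

variable {R : Type*} [CommRing R] [Algebra R A] {n : ℕ}

/-- Products of words in the image of a basis. -/
noncomputable def wordProd (j : L →ₗ⁅F⁆ A) (b : Module.Basis (Fin n) F L) (w : List (Fin n)) : A :=
  (w.map fun i => j (b i)).prod

variable (R) in
/-- The span of the products of short words. -/
noncomputable def wordSpan (j : L →ₗ⁅F⁆ A) (b : Module.Basis (Fin n) F L) (d : ℕ) : Submodule R A :=
  Submodule.span R (wordProd j b '' {w | w.length < d})

theorem wordProd_mem_wordSpan (j : L →ₗ⁅F⁆ A) (b : Module.Basis (Fin n) F L) {d : ℕ}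
    {w : List (Fin n)} (hw : w.length < d) : wordProd j b w ∈ wordSpan R j b d :=
  Submodule.subset_span ⟨w, hw, rfl⟩

theorem mul_mem_wordSpan (j : L →ₗ⁅F⁆ A) (b : Module.Basis (Fin n) F L) {d : ℕ} (i : Fin n) {a : A}
    (ha : a ∈ wordSpan R j b d) : j (b i) * a ∈ wordSpan R j b (d + 1) := by
  have : wordSpan R j b d ≤ (wordSpan R j b (d + 1)).comap (LinearMap.mulLeft R (j (b i))) := by
    rw [wordSpan, Submodule.span_le]
    rintro _ ⟨w, hw, rfl⟩
    refine Submodule.subset_span ⟨i :: w, by simpa using hw, ?_⟩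
    simp [wordProd]
  exact this ha

theorem wordProd_sub_mem_of_perm [Algebra F R] [IsScalarTower F R A] (j : L →ₗ⁅F⁆ A)
    (b : Module.Basis (Fin n) F L) {w w' : List (Fin n)} (h : w.Perm w') :
    wordProd j b w - wordProd j b w' ∈ wordSpan R j b w.length := by
  induction h with
  | nil => simp
  | @cons a w w' h ih =>
    have := mul_mem_wordSpan j b a ih
    rwa [mul_sub] at this
  | swap x y l =>
    have h₁ : wordProd j b (y :: x :: l) - wordProd j b (x :: y :: l) =
        ∑ k, b.repr ⁅b y, b x⁆ k • wordProd j b (k :: l) := by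
      have h₂ : j ⁅b y, b x⁆ = ∑ k, b.repr ⁅b y, b x⁆ k • j (b k) := by
        conv_lhs => rw [← b.sum_repr ⁅b y, b x⁆]
        simp only [map_sum, map_smul]
      rw [LieHom.map_lie, LieRing.of_associative_ring_bracket] at h₂
      simp only [wordProd, List.map_cons, List.prod_cons, ← mul_assoc, ← sub_mul, h₂,
        Finset.sum_mul, smul_mul_assoc]
    rw [h₁]
    refine Submodule.sum_mem _ fun k _ => Submodule.smul_of_tower_mem _ _ ?_
    exact wordProd_mem_wordSpan j b (by simp)
  | trans h₁ _ ih₁ ih₂ =>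
    rw [← h₁.length_eq] at ih₂
    simpa using Submodule.add_mem _ ih₁ ih₂

theorem finite_of_pow_eq [Algebra F R] [IsScalarTower F R A] (j : L →ₗ⁅F⁆ A)
    (b : Module.Basis (Fin n) F L)
    (hj : Algebra.adjoin F (Set.range fun i => j (b i)) = ⊤) {p : ℕ} (hp : 1 < p) (J : Fin n → ℕ)
    (d : Fin n → ℕ → F) (z : Fin n → R)
    (h : ∀ i, j (b i) ^ p ^ J i =
      algebraMap R A (z i) + ∑ k ∈ Finset.range (J i), d i k • j (b i) ^ p ^ k) :
    Module.Finite R A := by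
  classical
  let Q := ∑ i, p ^ J i
  let N : Submodule R A := wordSpan R j b (n * Q + 1)
  have hN : ∀ l w, w.length = l → wordProd j b w ∈ N := by
    intro l
    induction l using Nat.strong_induction_on with
    | _ l ih =>
    intro w hw
    by_cases hl : l ≤ n * Q
    · exact wordProd_mem_wordSpan j b (by omega)
    have hle : wordSpan R j b l ≤ N := by
      rw [wordSpan, Submodule.span_le]
      rintro _ ⟨v, hv, rfl⟩
      exact ih _ hv v rfl
    refine hle ?_
    obtain ⟨i, hi⟩ : ∃ i, p ^ J i ≤ w.count i := by
      by_contra! hcon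
      have h₁ : ∑ i, w.count i = w.length := by
        have := Multiset.sum_count_eq_card (s := Finset.univ) (m := (w : Multiset (Fin n)))
          (fun _ _ => Finset.mem_univ _)
        simpa using this
      have h₂ : ∑ i, w.count i ≤ Q := Finset.sum_le_sum fun i _ => (hcon i).le
      have h₃ : n ≠ 0 := by
        rintro rfl
        simp at h₁
        omega
      have : Q ≤ n * Q := Nat.le_mul_of_pos_left _ (Nat.pos_of_ne_zero h₃)
      omega
    obtain ⟨r, hr⟩ := (List.replicate_sublist_iff.2 hi).exists_perm_append
    have hmem := wordProd_sub_mem_of_perm (R := R) j b hr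
    rw [hw] at hmem
    have hlen : w.length = p ^ J i + r.length := by rw [hr.length_eq]; simp
    have hpos : 0 < p ^ J i := by positivity
    have hrep : ∀ k, wordProd j b (List.replicate k i ++ r) = j (b i) ^ k * wordProd j b r := by
      intro k
      simp [wordProd]
    rw [← sub_add_cancel (wordProd j b w) (wordProd j b (List.replicate (p ^ J i) i ++ r))]
    refine Submodule.add_mem _ hmem ?_
    rw [hrep, h i, add_mul, Finset.sum_mul, ← Algebra.smul_def]
    refine Submodule.add_mem _ (Submodule.smul_mem _ _ (wordProd_mem_wordSpan j b (by omega)))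
      (Submodule.sum_mem _ fun k hk => ?_)
    rw [smul_mul_assoc, ← hrep]
    refine Submodule.smul_of_tower_mem _ _ (wordProd_mem_wordSpan j b ?_)
    have := Nat.pow_lt_pow_right hp (Finset.mem_range.1 hk)
    rw [List.length_append, List.length_replicate]
    omega
  refine ⟨Submodule.fg_def.2 ⟨_, ?_, (eq_top_iff.2 ?_ : N = ⊤)⟩⟩
  · refine Set.Finite.image _ ?_
    exact List.finite_length_lt _ _
  · intro a _
    have ha : a ∈ Algebra.adjoin F (Set.range fun i => j (b i)) := hj ▸ Algebra.mem_top
    rw [← Subalgebra.mem_toSubmodule, Algebra.adjoin_eq_span] at ha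
    refine (Submodule.span_le (p := N.restrictScalars F)).2 ?_ ha
    intro c hc
    obtain ⟨l, hl, rfl⟩ := Submonoid.exists_list_of_mem_closure hc
    obtain ⟨w, rfl⟩ : l ∈ Set.range (List.map fun i => j (b i)) := by
      rw [Set.range_list_map]
      exact hl
    exact hN _ w rfl

end Words

end LieHom

section ResidualFiniteness

variable {F R : Type*} [Field F] [CommRing R] [Algebra F R]

theorem Ideal.moduleFinite_quotient_pow [Algebra.FiniteType F R] (m : Ideal R) [hm : m.IsMaximal]
    (k : ℕ) : Module.Finite F (R ⧸ m ^ k) := by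
  rw [Module.finite_iff_krullDimLE_zero]
  refine Ring.KrullDimLE.mk₀ fun P hP => ?_
  have hsurj := Ideal.Quotient.mk_surjective (I := m ^ k)
  have hle : m ≤ P.comap (Ideal.Quotient.mk (m ^ k)) := by
    refine Ideal.IsPrime.le_of_pow_le (n := k) ?_
    intro a ha
    rw [Ideal.mem_comap, Ideal.Quotient.eq_zero_iff_mem.2 ha]
    exact P.zero_mem
  have hmax : (P.comap (Ideal.Quotient.mk (m ^ k))).IsMaximal := by
    rw [← hm.eq_of_le (Ideal.IsPrime.ne_top inferInstance) hle]
    exact hm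
  rw [← Ideal.map_comap_of_surjective _ hsurj P]
  refine (Ideal.map_eq_top_or_isMaximal_of_surjective _ hsurj hmax).resolve_left ?_
  rw [Ideal.map_comap_of_surjective _ hsurj P]
  exact hP.ne_top

theorem Ideal.moduleFinite_quotient_inf (I J : Ideal R) [Module.Finite F (R ⧸ I)]
    [Module.Finite F (R ⧸ J)] : Module.Finite F (R ⧸ (I ⊓ J)) := by
  let g : R →ₐ[F] (R ⧸ I) × (R ⧸ J) :=
    (Ideal.Quotient.mkₐ F I).prod (Ideal.Quotient.mkₐ F J)
  have hg : RingHom.ker g = I ⊓ J := by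
    ext a
    simp [g, RingHom.mem_ker, Ideal.Quotient.eq_zero_iff_mem]
  rw [← hg]
  exact Module.Finite.of_injective (Ideal.kerLiftAlg g).toLinearMap (Ideal.kerLiftAlg_injective g)

theorem Module.exists_notMem_smul_top (F : Type*) [Field F] [Algebra F R] [Algebra.FiniteType F R]
    {M : Type*} [AddCommGroup M] [Module R M] [Module.Finite R M] {x : M} (hx : x ≠ 0) :
    ∃ I : Ideal R, Module.Finite F (R ⧸ I) ∧ x ∉ (I • ⊤ : Submodule R M) := by
  have : IsNoetherianRing R := Algebra.FiniteType.isNoetherianRing F R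
  have hne : LinearMap.ker (LinearMap.toSpanSingleton R M x) ≠ ⊤ := by
    rw [Ideal.ne_top_iff_one]
    simpa using hx
  obtain ⟨m, hm, hle⟩ := Ideal.exists_le_maximal _ hne
  by_contra! h
  have hmem : x ∈ (⨅ i : ℕ, m ^ i • ⊤ : Submodule R M) :=
    (Submodule.mem_iInf _).2 fun i => h _ (Ideal.moduleFinite_quotient_pow m i)
  obtain ⟨r, hr⟩ := (Ideal.mem_iInf_smul_pow_eq_bot_iff m x).1 hmem
  have h₁ : 1 - (r : R) ∈ m := hle (by simp [sub_smul, hr])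
  have h₂ := m.add_mem h₁ r.2
  rw [sub_add_cancel] at h₂
  exact hm.ne_top ((Ideal.eq_top_iff_one m).2 h₂)

theorem LinearMap.exists_ideal_map_notMem_smul_top {L M : Type*} [AddCommGroup L] [Module F L]
    [FiniteDimensional F L] [Algebra.FiniteType F R] [AddCommGroup M] [Module R M] [Module F M]
    [IsScalarTower F R M] [Module.Finite R M] (j : L →ₗ[F] M) (hj : Function.Injective j) :
    ∃ I : Ideal R, Module.Finite F (R ⧸ I) ∧ ∀ x, j x ∈ (I • ⊤ : Submodule R M) → x = 0 := by
  let S : Set (Submodule F L) := {K | ∃ I : Ideal R, Module.Finite F (R ⧸ I) ∧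
    ((I • ⊤ : Submodule R M).restrictScalars F).comap j = K}
  have hS : S.Nonempty := by
    refine ⟨_, ⊤, ?_, rfl⟩
    infer_instance
  obtain ⟨K, ⟨I, hI, rfl⟩, hmin⟩ := wellFounded_lt.has_min S hS
  refine ⟨I, hI, fun x hx => ?_⟩
  by_contra hne
  obtain ⟨I', hI', hx'⟩ := Module.exists_notMem_smul_top (R := R) F
    (fun h => hne (hj (h.trans (map_zero j).symm)) : j x ≠ 0)
  refine hmin _ ⟨I ⊓ I', Ideal.moduleFinite_quotient_inf I I', rfl⟩ (lt_of_le_of_ne ?_ fun h => ?_)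
  · exact fun y hy => (Submodule.smul_mono_left inf_le_left : _ ≤ (I • ⊤ : Submodule R M)) hy
  · have h₁ : x ∈ ((I • ⊤ : Submodule R M).restrictScalars F).comap j := hx
    rw [← h] at h₁
    exact hx' ((Submodule.smul_mono_left inf_le_right : _ ≤ (I' • ⊤ : Submodule R M)) h₁)

end ResidualFiniteness

theorem UniversalEnvelopingAlgebra.adjoin_range_ι (F L : Type*) [Field F] [LieRing L]
    [LieAlgebra F L] :
    Algebra.adjoin F (Set.range (ι F : L → UniversalEnvelopingAlgebra F L)) = ⊤ := by
  let S := Algebra.adjoin F (Set.range (ι F : L → UniversalEnvelopingAlgebra F L))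
  let g : L →ₗ⁅F⁆ S :=
    { toFun := fun x => ⟨ι F x, Algebra.subset_adjoin ⟨x, rfl⟩⟩
      map_add' := fun x y => Subtype.ext (map_add _ _ _)
      map_smul' := fun c x => Subtype.ext (map_smul _ _ _)
      map_lie' := fun {x y} => Subtype.ext (LieHom.map_lie _ _ _) }
  have h : S.val.comp (lift F g) = AlgHom.id F _ := by
    refine hom_ext F (LieHom.ext fun x => ?_)
    have : lift F g (ι F x) = g x := lift_ι_apply F g x
    change S.val (lift F g (ι F x)) = ι F x
    rw [this]
    rfl
  rw [eq_top_iff]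
  intro a _
  have := AlgHom.congr_fun h a
  rw [AlgHom.id_apply] at this
  rw [← this]
  exact (lift F g a).2

/-- Every finite-dimensional Lie algebra in positive characteristic has a finite-dimensional
representation with a vector killed by no nonzero element. -/
theorem LieAlgebra.exists_rep_apply_ne_zero {F L : Type} [Field F] [LieRing L] [LieAlgebra F L]
    {p : ℕ} [Fact p.Prime] [CharP F p] [FiniteDimensional F L] :
    ∃ (M : Type) (_ : AddCommGroup M) (_ : Module F M) (_ : FiniteDimensional F M)
      (φ : L →ₗ⁅F⁆ Module.End F M) (m : M), ∀ x, x ≠ 0 → φ x m ≠ 0 := by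
  let A := UniversalEnvelopingAlgebra F L
  let j : L →ₗ⁅F⁆ A := UniversalEnvelopingAlgebra.ι F
  have hinj : Function.Injective j := UniversalEnvelopingAlgebra.ι_injective F L
  have hadj : Algebra.adjoin F (Set.range j) = ⊤ := UniversalEnvelopingAlgebra.adjoin_range_ι F L
  have hnt : Nontrivial A :=
    (UniversalEnvelopingAlgebra.lift F (0 : L →ₗ⁅F⁆ F)).toRingHom.domain_nontrivial
  let b := Module.finBasis F L
  have hadj' : Algebra.adjoin F (Set.range fun i => j (b i)) = ⊤ := by
    rw [eq_top_iff, ← hadj, Algebra.adjoin_le_iff]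
    rintro _ ⟨x, rfl⟩
    rw [← b.sum_repr x]
    simp only [map_sum, map_smul]
    exact Subalgebra.sum_mem _ fun i _ =>
      Subalgebra.smul_mem _ (Algebra.subset_adjoin (Set.mem_range_self i)) _
  choose J d z hz hJ using fun i => LieHom.exists_central_sub_pow (p := p) j hadj (b i)
  let R := MvPolynomial (Fin (Module.finrank F L)) F
  let f : R →ₐ[F] Subalgebra.center F A := MvPolynomial.aeval fun i => ⟨z i, hz i⟩
  let _ : Algebra R A := ((Subalgebra.center F A).val.comp f).toRingHom.toAlgebra' fun r a =>
    (Subalgebra.mem_center_iff.1 (f r).2 a).symm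
  have htower : IsScalarTower F R A := by
    refine IsScalarTower.of_algebraMap_eq fun c => ?_
    exact (AlgHom.commutes ((Subalgebra.center F A).val.comp f) c).symm
  have hfin : Module.Finite R A := by
    refine LieHom.finite_of_pow_eq j b hadj' (Fact.out : p.Prime).one_lt J d MvPolynomial.X
      fun i => ?_
    have : algebraMap R A (MvPolynomial.X i) = z i := by
      change ((f (MvPolynomial.X i) : Subalgebra.center F A) : A) = z i
      rw [MvPolynomial.aeval_X]
    rw [this]
    exact hJ i
  obtain ⟨I, hI, hjI⟩ := LinearMap.exists_ideal_map_notMem_smul_top (R := R) (j : L →ₗ[F] A) hinj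
  let N : Submodule R A := I • ⊤
  have hN : ∀ a : A, N ≤ N.comap (LinearMap.mulLeft R a) := fun a => by
    rw [← Submodule.map_le_iff_le_comap, Submodule.map_smul'']
    exact Submodule.smul_mono le_rfl le_top
  have hfinN : FiniteDimensional F (A ⧸ N) := Module.Finite.trans (R ⧸ I) _
  refine ⟨A ⧸ N, inferInstance, inferInstance, hfinN,
    { toFun := fun x => (N.mapQ N (LinearMap.mulLeft R (j x)) (hN _)).restrictScalars F
      map_add' := fun x y => ?_
      map_smul' := fun c x => ?_
      map_lie' := fun {x y} => ?_ }, N.mkQ 1, fun x hx h => hx (hjI x ?_)⟩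
  · refine LinearMap.ext fun v => ?_
    obtain ⟨a, rfl⟩ := N.mkQ_surjective v
    exact (congrArg N.mkQ (by rw [map_add, LinearMap.mulLeft_apply, add_mul])).trans
      (map_add N.mkQ (j x * a) (j y * a))
  · refine LinearMap.ext fun v => ?_
    obtain ⟨a, rfl⟩ := N.mkQ_surjective v
    exact congrArg N.mkQ (by rw [map_smul]; exact smul_mul_assoc c (j x) a)
  · refine LinearMap.ext fun v => ?_
    obtain ⟨a, rfl⟩ := N.mkQ_surjective v
    exact (congrArg N.mkQ (by rw [LieHom.map_lie, LinearMap.mulLeft_apply,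
      LieRing.of_associative_ring_bracket, sub_mul, mul_assoc, mul_assoc])).trans
      (map_sub N.mkQ (j x * (j y * a)) (j y * (j x * a)))
  · have : N.mkQ (j x * 1) = 0 := h
    rw [mul_one] at this
    exact (Submodule.Quotient.mk_eq_zero N).1 this

/-- A nonzero finite-dimensional representation in which every nonzero element acts injectively
contains a faithful irreducible one. -/
theorem FaithfulIrredMod.nonempty_of_injective {F L V : Type} [Field F] [LieRing L]
    [LieAlgebra F L] [AddCommGroup V] [Module F V] [FiniteDimensional F V] [Nontrivial V]
    (φ : L →ₗ⁅F⁆ Module.End F V) (hφ : ∀ x, x ≠ 0 → Function.Injective (φ x)) :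
    Nonempty (FaithfulIrredMod F L) := by
  let : LieRingModule L V := LieRingModule.compLieHom V φ
  have : LieModule F L V := LieModule.compLieHom V φ
  obtain ⟨W, hW, -⟩ := (IsAtomic.eq_bot_or_exists_atom_le (⊤ : LieSubmodule F L V)).resolve_left
    top_ne_bot
  have : Nontrivial W := (LieSubmodule.nontrivial_iff_ne_bot F L V).2 hW.1
  refine ⟨⟨W, inferInstanceAs (FiniteDimensional F (W : Submodule F V)), ?_, ?_⟩⟩
  · refine LieModule.IsIrreducible.mk fun N hN => ?_
    have hle : N.map W.incl ≤ W := by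
      rintro _ ⟨w, -, rfl⟩
      exact w.2
    rcases hW.le_iff.1 hle with h | h
    · refine (hN ?_).elim
      rw [eq_bot_iff]
      intro w hw
      have : (w : V) ∈ N.map W.incl := ⟨w, hw, rfl⟩
      rw [h] at this
      exact Subtype.ext this
    · rw [eq_top_iff]
      intro w _
      have : (w : V) ∈ N.map W.incl := by rw [h]; exact w.2
      obtain ⟨w', hw', h'⟩ := this
      rwa [← Subtype.ext h']
  · rw [injective_iff_map_eq_zero]
    intro x hx
    by_contra hne
    obtain ⟨w, hw⟩ := exists_ne (0 : W)
    refine hw (Subtype.ext (hφ x hne ?_))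
    have h2 : (⁅x, w⁆ : W) = 0 := by
      rw [← LieModule.toEnd_apply_apply F, hx, LinearMap.zero_apply]
    have h3 : φ x (w : V) = 0 := congrArg Subtype.val h2
    rw [h3]
    simp

/-- Over a field of positive characteristic which is not algebraically closed, every
finite-dimensional Lie algebra has a nonzero finite-dimensional representation in which every
nonzero element acts injectively. -/
theorem LieAlgebra.exists_rep_injective {F L : Type} [Field F] [LieRing L] [LieAlgebra F L]
    {p : ℕ} [Fact p.Prime] [CharP F p] [FiniteDimensional F L] (hF : ¬ IsAlgClosed F) :
    ∃ (V : Type) (_ : AddCommGroup V) (_ : Module F V) (_ : FiniteDimensional F V)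
      (_ : Nontrivial V) (φ : L →ₗ⁅F⁆ Module.End F V),
      ∀ x, x ≠ 0 → Function.Injective (φ x) := by
  obtain ⟨M, _, _, _, φ, m, hm⟩ := exists_rep_apply_ne_zero (F := F) (L := L) (p := p)
  obtain ⟨V, _, _, _, _, ρ, hρ⟩ := Module.End.exists_rep_injective (p := p) hF m
  exact ⟨V, _, _, ‹_›, ‹_›, ρ.comp φ, fun x hx => hρ _ (hm x hx)⟩

end Representations

/-- **Main Theorem.** Let `L` be a finite-dimensional Lie algebra over a
field `F` of characteristic `p ≠ 0` which is not algebraically closed.  Then there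
exists a finite-dimensional faithful irreducible `L`-module. -/
theorem exists_faithful_irreducible_module
    {F L : Type} [Field F] [LieRing L] [LieAlgebra F L] {p : ℕ}
    [CharP F p] (hp : p ≠ 0) [FiniteDimensional F L]
    (hF : ¬ IsAlgClosed F) :
    Nonempty (FaithfulIrredMod F L) := by
  have : Fact p.Prime := ⟨(CharP.char_is_prime_or_zero F p).resolve_right hp⟩
  obtain ⟨V, _, _, _, _, φ, hφ⟩ := LieAlgebra.exists_rep_injective (L := L) (p := p) hF
  exact FaithfulIrredMod.nonempty_of_injective φ hφ
end

section
/- Let $L$ be a finite-dimensional Lie algebra over the algebraically closed field $F$ of characteristic $p \ne 0$. Then $L$ has a finite-dimensional faithful irreducible module if and only if for each abelian minimal ideal $A$ of $L$, the multiplicity of the $L$-module isomorphism type of $A$ in the abelian socle is at most $\dim_F(A)$. -/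
/-- The multiplicity condition: whenever `A 0, …, A (r-1)` are pairwise isomorphic
abelian minimal ideals whose sum is direct, `r ≤ dim_F (A 0)`; that is, the multiplicity
of the isomorphism type of each abelian minimal ideal in the abelian socle is at most
its dimension. -/
def MultiplicityCondition (F L : Type) [Field F] [LieRing L] [LieAlgebra F L] : Prop :=
  ∀ (r : ℕ) (hr : 0 < r) (A : Fin r → LieIdeal F L),
    (∀ i, IsAtom (A i)) →
    (∀ i, ∀ a ∈ A i, ∀ b ∈ A i, ⁅a, b⁆ = (0 : L)) →
    iSupIndep A →
    (∀ i, Nonempty (↥(A ⟨0, hr⟩) ≃ₗ⁅F,L⁆ ↥(A i))) →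
    r ≤ Module.finrank F ↥(A ⟨0, hr⟩)

namespace PBW

open MvPolynomial

variable {F L : Type*} [Field F] [LieRing L] [LieAlgebra F L] {n : ℕ}

/-- The action of the `i`-th basis vector on the monomial with exponent `m`, in the
Poincaré–Birkhoff–Witt representation on polynomials. The bound on degrees inside the sum always
holds (see `act_sub_mem`) and only serves to make the recursion terminate. -/
noncomputable def actMonomial (e : Module.Basis (Fin n) F L) (m : Fin n →₀ ℕ) (i : Fin n) :
    MvPolynomial (Fin n) F :=
  if h : ∃ k ∈ m.support, k < i then
    (∑ q ∈ (actMonomial e (m - Finsupp.single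
        (m.support.min' ⟨h.choose, h.choose_spec.1⟩) 1) i).support,
      if q.degree ≤ m.degree then
        coeff q (actMonomial e (m - Finsupp.single
          (m.support.min' ⟨h.choose, h.choose_spec.1⟩) 1) i) •
        actMonomial e q (m.support.min' ⟨h.choose, h.choose_spec.1⟩)
      else 0) +
    ∑ l, e.repr ⁅e i, e (m.support.min' ⟨h.choose, h.choose_spec.1⟩)⁆ l •
      actMonomial e (m - Finsupp.single (m.support.min' ⟨h.choose, h.choose_spec.1⟩) 1) l
  else X i * monomial m 1
termination_by (m.degree, i)
decreasing_by
  all_goals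
    have hj := m.support.min'_mem ⟨h.choose, h.choose_spec.1⟩
    have hji : m.support.min' ⟨h.choose, h.choose_spec.1⟩ < i :=
      (m.support.min'_le _ h.choose_spec.1).trans_lt h.choose_spec.2
    generalize m.support.min' ⟨h.choose, h.choose_spec.1⟩ = j at *
    have hd : (m - Finsupp.single j 1).degree < m.degree := by
      have h1 : Finsupp.single j 1 ≤ m := by
        simpa [Nat.one_le_iff_ne_zero] using hj
      have h2 : (m - Finsupp.single j 1 + Finsupp.single j 1).degree = m.degree := by
        rw [tsub_add_cancel_of_le h1]
      rw [map_add, Finsupp.degree_single] at h2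
      omega
  · exact Prod.Lex.left _ _ hd
  · rename_i hq
    rcases hq.lt_or_eq with hq | hq
    · exact Prod.Lex.left _ _ hq
    · rw [hq]; exact Prod.Lex.right _ hji
  · exact Prod.Lex.left _ _ hd

variable (e : Module.Basis (Fin n) F L)

/-- The action of the `i`-th basis vector in the Poincaré–Birkhoff–Witt representation. -/
noncomputable def act (i : Fin n) : Module.End F (MvPolynomial (Fin n) F) :=
  (basisMonomials (Fin n) F).constr F fun m ↦ actMonomial e m i

/-- The Poincaré–Birkhoff–Witt representation on polynomials. -/
noncomputable def rep : L →ₗ[F] Module.End F (MvPolynomial (Fin n) F) :=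
  e.constr F (act e)

lemma rep_basis (i : Fin n) : rep e (e i) = act e i := by simp [rep]

lemma act_monomial (i : Fin n) (m : Fin n →₀ ℕ) :
    act e i (monomial m 1) = actMonomial e m i := by
  have := (basisMonomials (Fin n) F).constr_basis F (fun m ↦ actMonomial e m i) m
  rwa [coe_basisMonomials] at this

/-- Polynomials of degree at most `d`. -/
noncomputable abbrev filt (F : Type*) [Field F] (n d : ℕ) : Submodule F (MvPolynomial (Fin n) F) :=
  restrictSupport F {q | q.degree ≤ d}

lemma filt_mono {d d' : ℕ} (h : d ≤ d') : filt F n d ≤ filt F n d' :=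
  restrictSupport_mono _ fun _ hq ↦ le_trans hq h

lemma eqOn_restrictSupport {W : Type*} [AddCommGroup W] [Module F W]
    {s : Set (Fin n →₀ ℕ)} {A B : MvPolynomial (Fin n) F →ₗ[F] W}
    (h : ∀ q ∈ s, A (monomial q 1) = B (monomial q 1)) {f : MvPolynomial (Fin n) F}
    (hf : f ∈ restrictSupport F s) : A f = B f := by
  rw [restrictSupport_eq_span] at hf
  refine LinearMap.eqOn_span ?_ hf
  rintro _ ⟨q, hq, rfl⟩
  exact h q hq

lemma map_restrictSupport_le {W : Type*} [AddCommGroup W] [Module F W]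
    {s : Set (Fin n →₀ ℕ)} {A : MvPolynomial (Fin n) F →ₗ[F] W} {N : Submodule F W}
    (h : ∀ q ∈ s, A (monomial q 1) ∈ N) {f : MvPolynomial (Fin n) F}
    (hf : f ∈ restrictSupport F s) : A f ∈ N := by
  rw [restrictSupport_eq_span] at hf
  suffices Submodule.span F ((monomial · 1) '' s) ≤ N.comap A from this hf
  rw [Submodule.span_le]
  rintro _ ⟨q, hq, rfl⟩
  exact h q hq

lemma act_monomial_of_le {i : Fin n} {m : Fin n →₀ ℕ} (h : ∀ k ∈ m.support, i ≤ k) :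
    act e i (monomial m 1) = X i * monomial m 1 := by
  rw [act_monomial, actMonomial, dif_neg]
  rintro ⟨k, hk, hki⟩
  exact (h k hk).not_gt hki

lemma rep_apply (x : L) (f : MvPolynomial (Fin n) F) :
    rep e x f = ∑ l, e.repr x l • act e l f := by
  simp [rep, Module.Basis.constr_apply_fintype, LinearMap.sum_apply]

lemma X_mul_monomial (j : Fin n) (m : Fin n →₀ ℕ) :
    (X j * monomial m 1 : MvPolynomial (Fin n) F) = monomial (Finsupp.single j 1 + m) 1 := by
  rw [X, monomial_mul, one_mul]

lemma X_mul_mem_filt (j : Fin n) {d : ℕ} {f : MvPolynomial (Fin n) F} (hf : f ∈ filt F n d) :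
    X j * f ∈ filt F n (d + 1) := by
  refine map_restrictSupport_le (A := LinearMap.mulLeft F (X j)) (fun q hq ↦ ?_) hf
  rw [LinearMap.mulLeft_apply, X_mul_monomial, monomial_mem_restrictSupport]
  left
  simp only [Set.mem_ofPred_eq, map_add, Finsupp.degree_single] at hq ⊢
  omega

lemma actMonomial_cons {i j : Fin n} (hji : j < i) {m : Fin n →₀ ℕ} (h : ∀ k ∈ m.support, j ≤ k) :
    actMonomial e (Finsupp.single j 1 + m) i =
      (∑ q ∈ (actMonomial e m i).support,
        if q.degree ≤ m.degree + 1 then coeff q (actMonomial e m i) • actMonomial e q j else 0) +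
      ∑ l, e.repr ⁅e i, e j⁆ l • actMonomial e m l := by
  have h0 : j ∈ (Finsupp.single j 1 + m).support := by simp
  have h1 : ∃ k ∈ (Finsupp.single j 1 + m).support, k < i := ⟨j, h0, hji⟩
  have h2 : ∀ h, (Finsupp.single j 1 + m).support.min' h = j := by
    intro hne
    refine le_antisymm (Finset.min'_le _ _ h0) (Finset.le_min' _ _ _ fun k hk ↦ ?_)
    by_cases hkj : j = k
    · exact hkj.le
    · refine h k ?_
      simpa [Finsupp.single_apply, hkj] using hk
  rw [actMonomial, dif_pos h1]
  have h3 := h2 ⟨h1.choose, h1.choose_spec.1⟩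
  generalize (Finsupp.single j 1 + m).support.min' ⟨h1.choose, h1.choose_spec.1⟩ = j' at h3 ⊢
  subst h3
  simp only [add_tsub_cancel_left, map_add, Finsupp.degree_single, add_comm 1]

/-- Splitting off the smallest variable of a nonconstant monomial. -/
lemma exists_eq_single_add {m : Fin n →₀ ℕ} (hm : m ≠ 0) :
    ∃ j m', m = Finsupp.single j 1 + m' ∧ (∀ k ∈ m.support, j ≤ k) ∧ ∀ k ∈ m'.support, j ≤ k := by
  have hne : m.support.Nonempty := Finsupp.support_nonempty_iff.mpr hm
  have hj := m.support.min'_mem hne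
  have h1 : Finsupp.single (m.support.min' hne) 1 ≤ m := by
    simpa [Nat.one_le_iff_ne_zero] using hj
  refine ⟨m.support.min' hne, m - Finsupp.single _ 1, (add_tsub_cancel_of_le h1).symm,
    fun k hk ↦ Finset.min'_le _ _ hk, fun k hk ↦ Finset.min'_le _ _ ?_⟩
  simp only [Finsupp.mem_support_iff, Finsupp.tsub_apply] at hk ⊢
  omega

lemma sum_support_eq_act_act (j : Fin n) {i : Fin n} {m : Fin n →₀ ℕ} {d : ℕ}
    (hmem : act e i (monomial m 1) ∈ filt F n d) :
    (∑ q ∈ (actMonomial e m i).support,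
      if q.degree ≤ d then coeff q (actMonomial e m i) • actMonomial e q j else 0) =
      act e j (act e i (monomial m 1)) := by
  rw [act_monomial] at hmem ⊢
  conv_rhs => rw [(actMonomial e m i).as_sum]
  rw [map_sum]
  refine Finset.sum_congr rfl fun q hq ↦ ?_
  rw [if_pos (show q.degree ≤ _ from (mem_restrictSupport_iff F).mp hmem hq),
    ← act_monomial e j q, ← map_smul, smul_monomial, smul_eq_mul, mul_one]

lemma act_sub_mem (d : ℕ) (i : Fin n) : ∀ m : Fin n →₀ ℕ, m.degree = d →
    act e i (monomial m 1) - X i * monomial m 1 ∈ filt F n d := by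
  induction d using Nat.strong_induction_on generalizing i with
  | _ d ihd =>
  induction i using WellFoundedLT.induction with
  | _ i ihi =>
  intro m hm
  have low : ∀ {d'} (_ : d' < d) (k : Fin n) (q : Fin n →₀ ℕ) (_ : q.degree = d'),
      act e k (monomial q 1) ∈ filt F n (d' + 1) := by
    intro d' hd' k q hq
    rw [← sub_add_cancel (act e k (monomial q 1)) (X k * monomial q 1)]
    refine add_mem (filt_mono (Nat.le_succ _) (ihd d' hd' k q hq)) (X_mul_mem_filt _ ?_)
    simp [hq]
  by_cases h : ∀ k ∈ m.support, i ≤ k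
  · rw [act_monomial_of_le e h, sub_self]; exact zero_mem _
  have hm0 : m ≠ 0 := by rintro rfl; simp at h
  obtain ⟨j, m', rfl, hj, hj'⟩ := exists_eq_single_add hm0
  push Not at h
  obtain ⟨k, hk, hki⟩ := h
  have hji : j < i := (hj k hk).trans_lt hki
  rw [map_add, Finsupp.degree_single] at hm
  rw [act_monomial, actMonomial_cons e hji hj']
  have hsum : (∑ q ∈ (actMonomial e m' i).support, if q.degree ≤ m'.degree + 1 then
      coeff q (actMonomial e m' i) • actMonomial e q j else 0) =
      act e j (act e i (monomial m' 1)) :=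
    sum_support_eq_act_act e j (low (by omega) i m' rfl)
  rw [hsum, add_sub_right_comm]
  refine add_mem ?_ (Submodule.sum_mem _ fun l _ ↦ Submodule.smul_mem _ _ ?_)
  · have h1 := ihd m'.degree (by omega) i m' rfl
    have h2 : ∀ f ∈ filt F n d,
        (act e j - LinearMap.mulLeft F (X j) : Module.End F (MvPolynomial (Fin n) F)) f ∈
          filt F n d := by
      intro f hf
      refine map_restrictSupport_le (fun q hq ↦ ?_) hf
      rcases (show q.degree ≤ d from hq).lt_or_eq with hq | hq
      · exact filt_mono hq.le (ihd _ hq j q rfl)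
      · exact ihi j hji q hq
    have h3 := h2 (act e i (monomial m' 1)) (filt_mono (by omega) (low (by omega) i m' rfl))
    have h4 := X_mul_mem_filt j h1
    have h5 := add_mem h3 (filt_mono (by omega : m'.degree + 1 ≤ d) h4)
    convert h5 using 1
    rw [← X_mul_monomial]
    simp only [LinearMap.sub_apply, LinearMap.mulLeft_apply]
    ring
  · rw [← act_monomial]
    exact filt_mono (by omega) (low (by omega) l m' rfl)

lemma act_mem_filt (i : Fin n) {d : ℕ} {f : MvPolynomial (Fin n) F} (hf : f ∈ filt F n d) :
    act e i f ∈ filt F n (d + 1) := by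
  refine map_restrictSupport_le (fun q hq ↦ ?_) hf
  rw [← sub_add_cancel (act e i (monomial q 1)) (X i * monomial q 1)]
  have hq : q.degree ≤ d := hq
  refine add_mem (filt_mono (by omega) (act_sub_mem e _ i q rfl)) (X_mul_mem_filt _ ?_)
  simpa using hq

lemma act_X_mul_monomial {i j : Fin n} (hji : j < i) {m : Fin n →₀ ℕ}
    (h : ∀ k ∈ m.support, j ≤ k) :
    act e i (X j * monomial m 1) =
      act e j (act e i (monomial m 1)) + rep e ⁅e i, e j⁆ (monomial m 1) := by
  have hmem : act e i (monomial m 1) ∈ filt F n (m.degree + 1) := act_mem_filt e i (by simp)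
  rw [X_mul_monomial, act_monomial, actMonomial_cons e hji h, rep_apply,
    sum_support_eq_act_act e j hmem]
  simp only [act_monomial]

lemma rep_lie_monomial (m : Fin n →₀ ℕ) (x y : L) :
    rep e ⁅x, y⁆ (monomial m 1) =
      rep e x (rep e y (monomial m 1)) - rep e y (rep e x (monomial m 1)) := by
  induction hd : m.degree using Nat.strong_induction_on generalizing m x y with
  | _ d ih =>
  have ih' : ∀ f ∈ restrictSupport F {q : Fin n →₀ ℕ | q.degree < d}, ∀ x y,
      rep e ⁅x, y⁆ f = rep e x (rep e y f) - rep e y (rep e x f) := by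
    intro f hf x y
    exact eqOn_restrictSupport (A := rep e ⁅x, y⁆)
      (B := rep e x * rep e y - rep e y * rep e x) (fun q hq ↦ ih _ hq q x y rfl) hf
  suffices H : ∀ i j : Fin n, j < i → rep e ⁅e i, e j⁆ (monomial m 1) =
      rep e (e i) (rep e (e j) (monomial m 1)) - rep e (e j) (rep e (e i) (monomial m 1)) by
    have H' : ∀ i j : Fin n, rep e ⁅e i, e j⁆ (monomial m 1) =
        rep e (e i) (rep e (e j) (monomial m 1)) - rep e (e j) (rep e (e i) (monomial m 1)) := by
      intro i j
      rcases lt_trichotomy i j with h | rfl | h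
      · rw [← lie_skew, map_neg, LinearMap.neg_apply, H j i h, neg_sub]
      · simp
      · exact H i j h
    induction e.mem_span x using Submodule.span_induction with
    | mem x hx =>
      obtain ⟨i, rfl⟩ := hx
      induction e.mem_span y using Submodule.span_induction with
      | mem y hy => obtain ⟨j, rfl⟩ := hy; exact H' i j
      | zero => simp
      | add y z _ _ hy hz => simp only [lie_add, map_add, LinearMap.add_apply, hy, hz]; ring
      | smul c y _ hy => simp only [lie_smul, map_smul, LinearMap.smul_apply, hy, smul_sub]
    | zero => simp
    | add y z _ _ hy hz => simp only [add_lie, map_add, LinearMap.add_apply, hy, hz]; ring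
    | smul c y _ hy => simp only [smul_lie, map_smul, LinearMap.smul_apply, hy, smul_sub]
  intro i j hji
  by_cases hjm : ∀ k ∈ m.support, j ≤ k
  · rw [rep_basis e i, rep_basis e j, act_monomial_of_le e hjm, act_X_mul_monomial e hji hjm]
    ring
  have hm0 : m ≠ 0 := by rintro rfl; simp at hjm
  obtain ⟨k, m', rfl, hk, hk'⟩ := exists_eq_single_add hm0
  push Not at hjm
  obtain ⟨l, hl, hlj⟩ := hjm
  have hkj : k < j := (hk l hl).trans_lt hlj
  rw [map_add, Finsupp.degree_single] at hd
  have hP : (monomial m' 1 : MvPolynomial (Fin n) F) ∈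
      restrictSupport F {q : Fin n →₀ ℕ | q.degree < d} := by
    simp only [monomial_mem_restrictSupport, Set.mem_ofPred_eq]; omega
  have key : ∀ a b, k < a → k < b →
      rep e ⁅e a, e k⁆ (rep e (e b) (monomial m' 1)) =
      rep e (e a) (rep e (e k) (rep e (e b) (monomial m' 1))) -
        rep e (e k) (rep e (e a) (rep e (e b) (monomial m' 1))) := by
    intro a b hka hkb
    have h1 : act e b (monomial m' 1) - X b * monomial m' 1 ∈
        restrictSupport F {q : Fin n →₀ ℕ | q.degree < d} :=
      restrictSupport_mono _ (fun q hq ↦ by simp only [Set.mem_ofPred_eq] at hq ⊢; omega)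
        (act_sub_mem e _ b m' rfl)
    have h2 := ih' _ h1 (e a) (e k)
    have hkb' : ∀ q ∈ (Finsupp.single b 1 + m').support, k ≤ q := by
      intro q hq
      by_cases hbq : b = q
      · exact hbq ▸ hkb.le
      · exact hk' q (by simpa [Finsupp.single_apply, hbq] using hq)
    have h3 := act_X_mul_monomial e hka hkb'
    rw [← act_monomial_of_le e hkb', ← X_mul_monomial] at h3
    simp only [map_sub, ← rep_basis e] at h2 h3 ⊢
    linear_combination h2 - h3
  have hv : (monomial (Finsupp.single k 1 + m') 1 : MvPolynomial (Fin n) F) =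
      rep e (e k) (monomial m' 1) := by
    rw [rep_basis, act_monomial_of_le e hk', X_mul_monomial]
  rw [hv]
  have e1 := key i j (hkj.trans hji) hkj
  have e2 := key j i hkj (hkj.trans hji)
  have e3 := ih' _ hP (e j) (e k)
  have e4 := ih' _ hP (e i) (e k)
  have e5 := ih' _ hP (e i) ⁅e j, e k⁆
  have e6 := ih' _ hP (e j) ⁅e i, e k⁆
  have e7 := ih' _ hP ⁅e i, e j⁆ (e k)
  have e8 := congrArg (rep e (e k)) (ih' _ hP (e i) (e j))
  have e3' := congrArg (rep e (e i)) e3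
  have e4' := congrArg (rep e (e j)) e4
  have e9 : rep e ⁅e i, ⁅e j, e k⁆⁆ (monomial m' 1) = rep e ⁅⁅e i, e j⁆, e k⁆ (monomial m' 1) +
      rep e ⁅e j, ⁅e i, e k⁆⁆ (monomial m' 1) := by
    rw [leibniz_lie, map_add, LinearMap.add_apply]
  simp only [map_sub] at e3' e4' e8
  linear_combination e1 - e2 + e3' - e4' + e5 - e6 - e7 + e8 - e9

lemma rep_lie (x y : L) : rep e ⁅x, y⁆ = rep e x * rep e y - rep e y * rep e x :=
  (basisMonomials (Fin n) F).ext fun m ↦ by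
    simpa only [coe_basisMonomials, LinearMap.sub_apply, Module.End.mul_apply] using
      rep_lie_monomial e m x y

end PBW

section Reduction

open Polynomial

/-- The module structure given by a linear map that turns brackets into commutators. -/
abbrev lieRingModuleOfRep {F L V : Type*} [Field F] [LieRing L] [LieAlgebra F L] [AddCommGroup V]
    [Module F V] (ρ : L →ₗ[F] Module.End F V) (h : ∀ x y, ρ ⁅x, y⁆ = ρ x * ρ y - ρ y * ρ x) :
    LieRingModule L V where
  bracket x v := ρ x v
  add_lie x y v := by simp
  lie_add x v w := by simp
  leibniz_lie x y v := by simp [h]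

lemma lieModule_ofRep {F L V : Type*} [Field F] [LieRing L] [LieAlgebra F L] [AddCommGroup V]
    [Module F V] (ρ : L →ₗ[F] Module.End F V) (h : ∀ x y, ρ ⁅x, y⁆ = ρ x * ρ y - ρ y * ρ x) :
    letI := lieRingModuleOfRep ρ h
    LieModule F L V :=
  letI := lieRingModuleOfRep ρ h
  { smul_lie c x v := by change ρ (c • x) v = c • ρ x v; simp
    lie_smul c x v := by change ρ x (c • v) = c • ρ x v; simp }

lemma aeval_intertwine {F V W : Type*} [Field F] [AddCommGroup V] [Module F V] [AddCommGroup W]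
    [Module F W] {A : Module.End F V} {B : Module.End F W} {T : V →ₗ[F] W}
    (h : ∀ v, T (A v) = B (T v)) (f : F[X]) (v : V) : T (aeval A f v) = aeval B f (T v) := by
  induction f using Polynomial.induction_on generalizing v with
  | C a => simp
  | add f g hf hg => simp [hf, hg]
  | monomial n a ih =>
    simp only [pow_succ, ← mul_assoc, map_mul, Module.End.mul_apply] at ih ⊢
    simp only [aeval_X, ih, h]

variable {F L V : Type*} [Field F] [LieRing L] [LieAlgebra F L] [AddCommGroup V] [Module F V]
  {p : ℕ} [CharP F p]

lemma rep_pow_commutator (hp : p ≠ 0) {ρ : L →ₗ[F] Module.End F V}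
    (h : ∀ x y, ρ ⁅x, y⁆ = ρ x * ρ y - ρ y * ρ x) (x y : L) (k : ℕ) :
    ρ x ^ p ^ k * ρ y - ρ y * ρ x ^ p ^ k = ρ ((LieAlgebra.ad F L x ^ p ^ k) y) := by
  rcases subsingleton_or_nontrivial V with hV | hV
  · exact Subsingleton.elim _ _
  have hprime : Fact p.Prime := ⟨(CharP.char_is_prime_or_zero F p).resolve_right hp⟩
  have hchar : CharP (Module.End F (Module.End F V)) p :=
    charP_of_injective_algebraMap (algebraMap F _).injective p
  have h1 : ∀ m : ℕ, ((LinearMap.mulLeft F (ρ x) - LinearMap.mulRight F (ρ x)) ^ m) (ρ y) =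
      ρ ((LieAlgebra.ad F L x ^ m) y) := by
    intro m
    induction m with
    | zero => simp
    | succ m ih => simp only [pow_succ', Module.End.mul_apply, ih]; simp [h]
  rw [← h1, sub_pow_expChar_pow_of_commute _ _ (LinearMap.commute_mulLeft_right _ _)]
  simp

lemma exists_central_polynomial [FiniteDimensional F L] (hp : p ≠ 0) {ρ : L →ₗ[F] Module.End F V}
    (h : ∀ x y, ρ ⁅x, y⁆ = ρ x * ρ y - ρ y * ρ x) (x : L) :
    ∃ f : F[X], f.Monic ∧ f.natDegree ≠ 0 ∧ f.coeff 0 = 0 ∧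
      (LieAlgebra.ad F L x ^ p = 0 → f = X ^ p) ∧ ∀ y, Commute (aeval (ρ x) f) (ρ y) := by
  by_cases hx : LieAlgebra.ad F L x ^ p = 0
  · refine ⟨X ^ p, monic_X_pow p, by simpa, by simp [coeff_X_pow, hp.symm], fun _ ↦ rfl,
      fun y ↦ ?_⟩
    have := rep_pow_commutator hp h x y 1
    rw [pow_one, hx] at this
    simpa [commute_iff_eq, sub_eq_zero] using this
  have hprime : p.Prime := (CharP.char_is_prime_or_zero F p).resolve_right hp
  let v : ℕ → Module.End F L := fun k ↦ LieAlgebra.ad F L x ^ p ^ k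
  obtain ⟨m, hm⟩ : ∃ m, v m ∈ Submodule.span F (v '' Finset.range m) := by
    let s : ℕ →o Submodule F (Module.End F L) :=
      ⟨fun m ↦ Submodule.span F (v '' Finset.range m), fun a b hab ↦ Submodule.span_mono
        (Set.image_mono (by simpa using hab))⟩
    obtain ⟨m, hm⟩ := monotone_stabilizes_iff_noetherian.mpr
      (inferInstance : IsNoetherian F (Module.End F L)) s
    refine ⟨m, ?_⟩
    have : v m ∈ s (m + 1) := Submodule.subset_span ⟨m, by simp, rfl⟩
    rwa [← hm (m + 1) (Nat.le_succ m)] at this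
  rw [Submodule.mem_span_image_finset_iff_exists_fun] at hm
  obtain ⟨c, hc⟩ := hm
  have hpk : ∀ k, p ^ k ≠ 0 := fun k ↦ pow_ne_zero _ hp
  have hdeg : (∑ k : Finset.range m, C (c k) * X ^ p ^ (k : ℕ) : F[X]).degree < (p ^ m : ℕ) := by
    refine (degree_sum_le _ _).trans_lt ?_
    rw [Finset.sup_lt_iff (by exact WithBot.bot_lt_coe _)]
    intro k hk
    refine (degree_C_mul_X_pow_le _ _).trans_lt ?_
    exact_mod_cast Nat.pow_lt_pow_right hprime.one_lt (Finset.mem_range.mp k.2)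
  refine ⟨X ^ p ^ m - ∑ k : Finset.range m, C (c k) * X ^ p ^ (k : ℕ), monic_X_pow_sub hdeg, ?_, ?_,
    fun h' ↦ absurd h' hx, fun y ↦ ?_⟩
  · rw [natDegree_eq_of_degree_eq_some (n := p ^ m)]
    · exact hpk m
    · rw [degree_sub_eq_left_of_degree_lt (by rwa [degree_X_pow]), degree_X_pow]
  · simp [coeff_X_pow, (hpk _).symm]
  · rw [commute_iff_eq, ← sub_eq_zero]
    simp only [map_sub, map_sum, map_mul, aeval_C, map_pow, aeval_X, ← Algebra.smul_def]
    have h1 : ρ ((v m) y) - ∑ k : Finset.range m, c k • ρ (v k y) = 0 := by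
      rw [← hc, LinearMap.sum_apply, map_sum, sub_eq_zero]
      simp
    simp only [v, ← rep_pow_commutator hp h x y] at h1
    rw [← h1, sub_mul, mul_sub, Finset.sum_mul, Finset.mul_sum]
    simp only [smul_sub, Finset.sum_sub_distrib, smul_mul_assoc, mul_smul_comm]
    abel

end Reduction

namespace PBW

open MvPolynomial

variable {F L : Type*} [Field F] [LieRing L] [LieAlgebra F L] {n : ℕ}
  (e : Module.Basis (Fin n) F L)

lemma le_of_mem_support_single_add {i j : Fin n} (hji : j ≤ i) {m : Fin n →₀ ℕ}
    (h : ∀ k ∈ m.support, j ≤ k) (c : ℕ) : ∀ k ∈ (Finsupp.single i c + m).support, j ≤ k := by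
  intro k hk
  by_cases hik : i = k
  · exact hik ▸ hji
  · exact h k (by simpa [Finsupp.single_apply, hik] using hk)

lemma X_pow_mul_monomial (i : Fin n) (m : Fin n →₀ ℕ) (c : ℕ) :
    (X i ^ c * monomial m 1 : MvPolynomial (Fin n) F) = monomial (Finsupp.single i c + m) 1 := by
  rw [X_pow_eq_monomial, monomial_mul, one_mul]

lemma act_pow_monomial_of_le {i : Fin n} {m : Fin n →₀ ℕ} (h : ∀ k ∈ m.support, i ≤ k) (c : ℕ) :
    (act e i ^ c) (monomial m 1) = X i ^ c * monomial m 1 := by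
  induction c with
  | zero => simp
  | succ c ih =>
    rw [pow_succ', Module.End.mul_apply, ih, X_pow_mul_monomial,
      act_monomial_of_le e (le_of_mem_support_single_add le_rfl h c), ← X_pow_mul_monomial]
    ring

lemma aeval_X_mul_monomial_mem {i j : Fin n} (hji : j ≤ i) {m : Fin n →₀ ℕ}
    (h : ∀ k ∈ m.support, j ≤ k) (f : Polynomial F) :
    Polynomial.aeval (X i : MvPolynomial (Fin n) F) f * monomial m 1 ∈
      restrictSupport F {q : Fin n →₀ ℕ | ∀ k ∈ q.support, j ≤ k} := by
  induction f using Polynomial.induction_on' with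
  | add f g hf hg => rw [map_add, add_mul]; exact add_mem hf hg
  | monomial c a =>
    rw [Polynomial.aeval_monomial, ← Algebra.smul_def, smul_mul_assoc, X_pow_mul_monomial]
    refine Submodule.smul_mem _ _ ?_
    rw [monomial_mem_restrictSupport]
    exact Or.inl (le_of_mem_support_single_add hji h c)

/-- Central polynomials in the `i`-th basis vector act by multiplication. -/
lemma aeval_act_eq_mul {i : Fin n} {f : Polynomial F}
    (hf : ∀ y, Commute (Polynomial.aeval (act e i) f) (rep e y)) (g : MvPolynomial (Fin n) F) :
    Polynomial.aeval (act e i) f g = Polynomial.aeval (X i) f * g := by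
  suffices H : Polynomial.aeval (act e i) f = LinearMap.mulLeft F (Polynomial.aeval (X i) f) by
    rw [H, LinearMap.mulLeft_apply]
  refine (basisMonomials (Fin n) F).ext fun m ↦ ?_
  simp only [coe_basisMonomials, LinearMap.mulLeft_apply]
  induction hd : m.degree using Nat.strong_induction_on generalizing m with
  | _ d ih =>
  by_cases him : ∀ k ∈ m.support, i ≤ k
  · clear hf ih
    induction f using Polynomial.induction_on' with
    | add f g hf hg => simp only [map_add, LinearMap.add_apply, hf, hg, add_mul]
    | monomial c a =>
      simp only [Polynomial.aeval_monomial, ← Algebra.smul_def, LinearMap.smul_apply,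
        act_pow_monomial_of_le e him, smul_mul_assoc]
  have hm0 : m ≠ 0 := by rintro rfl; simp at him
  obtain ⟨j, m', rfl, hj, hj'⟩ := exists_eq_single_add hm0
  push Not at him
  obtain ⟨k, hk, hki⟩ := him
  have hji : j < i := (hj k hk).trans_lt hki
  rw [map_add, Finsupp.degree_single] at hd
  have h1 := LinearMap.congr_fun (hf (e j)).eq (monomial m' 1)
  rw [rep_basis, Module.End.mul_apply, Module.End.mul_apply, act_monomial_of_le e hj',
    ih _ (by omega) m' rfl, eqOn_restrictSupport (A := act e j) (B := LinearMap.mulLeft F (X j))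
    (fun q hq ↦ act_monomial_of_le e hq) (aeval_X_mul_monomial_mem hji.le hj' f)] at h1
  rw [← X_mul_monomial, h1, LinearMap.mulLeft_apply]
  ring

end PBW

section Reduced

open MvPolynomial

variable {F L : Type*} [Field F] [LieRing L] [LieAlgebra F L]

lemma finite_quotient_span_aeval_X {n : ℕ} {f : Fin n → Polynomial F} (hf : ∀ i, (f i).Monic) :
    Module.Finite F (MvPolynomial (Fin n) F ⧸
      Ideal.span (Set.range fun i ↦ Polynomial.aeval (X i : MvPolynomial (Fin n) F) (f i))) := by
  set J : Ideal (MvPolynomial (Fin n) F) :=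
    Ideal.span (Set.range fun i ↦ Polynomial.aeval (X i) (f i))
  have : Algebra.IsIntegral F (MvPolynomial (Fin n) F ⧸ J) := ⟨fun x ↦ by
    obtain ⟨x, rfl⟩ := Ideal.Quotient.mkₐ_surjective F J x
    induction x using MvPolynomial.induction_on with
    | C a =>
      rw [← MvPolynomial.algebraMap_eq, AlgHom.commutes]
      exact isIntegral_algebraMap
    | add p q hp hq => rw [map_add]; exact hp.add hq
    | mul_X p i hp =>
      rw [map_mul]
      refine hp.mul ⟨f i, hf i, ?_⟩
      rw [← Polynomial.aeval_def, Polynomial.aeval_algHom_apply]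
      exact Ideal.Quotient.eq_zero_iff_mem.mpr (Ideal.subset_span ⟨i, rfl⟩)⟩
  exact Algebra.IsIntegral.finite

lemma span_aeval_X_ne_top [IsAlgClosed F] {n : ℕ} {f : Fin n → Polynomial F}
    (hf : ∀ i, (f i).degree ≠ 0) :
    Ideal.span (Set.range fun i ↦ Polynomial.aeval (X i : MvPolynomial (Fin n) F) (f i)) ≠ ⊤ := by
  choose r hr using fun i ↦ IsAlgClosed.exists_root (f i) (hf i)
  have h : Ideal.span (Set.range fun i ↦
      Polynomial.aeval (X i : MvPolynomial (Fin n) F) (f i)) ≤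
      RingHom.ker (MvPolynomial.aeval r : MvPolynomial (Fin n) F →ₐ[F] F) := by
    rw [Ideal.span_le]
    rintro _ ⟨i, rfl⟩
    have := hr i
    simp only [SetLike.mem_coe, RingHom.mem_ker, ← Polynomial.aeval_algHom_apply, aeval_X]
    simpa using this
  exact fun ht ↦ RingHom.ker_ne_top _ (top_le_iff.mp (ht ▸ h))

lemma IsAtom.isIrreducible {V : Type*} [AddCommGroup V] [Module F V] [LieRingModule L V]
    [LieModule F L V] {W : LieSubmodule F L V} (hW : IsAtom W) : LieModule.IsIrreducible F L W := by
  have : Nontrivial W := (LieSubmodule.nontrivial_iff_ne_bot F L V).mpr hW.1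
  refine LieModule.IsIrreducible.mk fun N hN ↦ ?_
  have h1 : N.map W.incl = W := by
    refine (hW.le_iff.mp (LieSubmodule.map_incl_le)).resolve_left fun h ↦ hN ?_
    rw [eq_bot_iff]
    intro x hx
    have : W.incl x ∈ N.map W.incl := LieSubmodule.mem_map_of_mem hx
    rw [h, LieSubmodule.mem_bot] at this
    simpa using this
  rw [eq_top_iff]
  rintro x -
  have hx : (x : V) ∈ N.map W.incl := by rw [h1]; exact x.2
  obtain ⟨y, hy, hyx⟩ := (LieSubmodule.mem_map _).mp hx
  rwa [← Subtype.ext hyx]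

lemma exists_isIrreducible_lieSubmodule {V : Type*} [AddCommGroup V] [Module F V]
    [LieRingModule L V] [LieModule F L V] [FiniteDimensional F V] [Nontrivial V] :
    ∃ W : LieSubmodule F L V, LieModule.IsIrreducible F L W := by
  obtain ⟨W, hW, -⟩ := (IsAtomic.eq_bot_or_exists_atom_le (⊤ : LieSubmodule F L V)).resolve_left
    top_ne_bot
  exact ⟨W, hW.isIrreducible⟩

theorem exists_irreducible_module {F L : Type} [Field F] [IsAlgClosed F] [LieRing L]
    [LieAlgebra F L] [FiniteDimensional F L] {p : ℕ} [CharP F p] (hp : p ≠ 0) {n : ℕ}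
    (e : Module.Basis (Fin n) F L) (a : Fin n → F) :
    ∃ (V : Type) (_ : AddCommGroup V) (_ : Module F V) (_ : LieRingModule L V)
      (_ : LieModule F L V), FiniteDimensional F V ∧ LieModule.IsIrreducible F L V ∧
      ∀ i, (a i ≠ 0 → LieModule.toEnd F L V (e i) ≠ 0) ∧
        (LieAlgebra.ad F L (e i) ^ p = 0 →
          LieModule.toEnd F L V (e i) ^ p = algebraMap F _ (a i)) := by
  choose f hmonic hdeg hcoeff hXp hcomm using
    fun i ↦ exists_central_polynomial hp (PBW.rep_lie e) (e i)
  have hCdeg : ∀ i, (Polynomial.C (a i)).degree < (f i).degree := fun i ↦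
    Polynomial.degree_C_le.trans_lt (Polynomial.natDegree_pos_iff_degree_pos.mp
      (Nat.pos_of_ne_zero (hdeg i)))
  set J : Ideal (MvPolynomial (Fin n) F) :=
    Ideal.span (Set.range fun i ↦ Polynomial.aeval (X i) (f i - Polynomial.C (a i))) with hJ
  have hfin : Module.Finite F (MvPolynomial (Fin n) F ⧸ J) :=
    finite_quotient_span_aeval_X fun i ↦ (hmonic i).sub_of_left (hCdeg i)
  have htop : J ≠ ⊤ := span_aeval_X_ne_top fun i ↦ by
    rw [Polynomial.degree_sub_eq_left_of_degree_lt (hCdeg i)]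
    exact (Polynomial.natDegree_pos_iff_degree_pos.mp (Nat.pos_of_ne_zero (hdeg i))).ne'
  have hact : ∀ i g, Polynomial.aeval (PBW.act e i) (f i) g = Polynomial.aeval (X i) (f i) * g := by
    intro i g
    refine PBW.aeval_act_eq_mul e (fun y ↦ ?_) g
    rw [← PBW.rep_basis]
    exact hcomm i y
  have hrep : ∀ y i g, PBW.rep e y (Polynomial.aeval (X i) (f i) * g) =
      Polynomial.aeval (X i) (f i) * PBW.rep e y g := by
    intro y i g
    rw [← hact, ← hact, ← PBW.rep_basis]
    exact (LinearMap.congr_fun (hcomm i y).eq g).symm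
  have hinv : ∀ y, J.restrictScalars F ≤ (J.restrictScalars F).comap (PBW.rep e y) := by
    intro y x hx
    obtain ⟨c, rfl⟩ := Submodule.mem_span_range_iff_exists_fun _ |>.mp hx
    simp only [Submodule.mem_comap, Submodule.restrictScalars_mem, map_sum]
    refine sum_mem fun i _ ↦ ?_
    have : PBW.rep e y (c i • Polynomial.aeval (X i) (f i - Polynomial.C (a i))) =
        PBW.rep e y (c i) * Polynomial.aeval (X i) (f i - Polynomial.C (a i)) := by
      rw [smul_eq_mul, map_sub, Polynomial.aeval_C, mul_comm, sub_mul, map_sub, hrep,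
        ← Algebra.smul_def, map_smul, Algebra.smul_def]
      ring
    rw [this]
    exact J.mul_mem_left _ (Ideal.subset_span ⟨i, rfl⟩)
  let ρ : L →ₗ[F] Module.End F (MvPolynomial (Fin n) F ⧸ J.restrictScalars F) :=
    { toFun := fun y ↦ Submodule.mapQ _ _ (PBW.rep e y) (hinv y)
      map_add' := fun x y ↦ by ext; simp
      map_smul' := fun c x ↦ by ext; simp }
  have hρ : ∀ x y, ρ ⁅x, y⁆ = ρ x * ρ y - ρ y * ρ x := fun x y ↦ by
    refine Submodule.linearMap_qext _ (LinearMap.ext fun g ↦ ?_)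
    simp [ρ, PBW.rep_lie]
  let := lieRingModuleOfRep ρ hρ
  have := lieModule_ofRep ρ hρ
  have hfin' : FiniteDimensional F (MvPolynomial (Fin n) F ⧸ J.restrictScalars F) :=
    Module.Finite.equiv (Submodule.Quotient.restrictScalarsEquiv F J).symm
  have hnontriv : Nontrivial (MvPolynomial (Fin n) F ⧸ J.restrictScalars F) :=
    Submodule.Quotient.nontrivial_iff.mpr (by simpa using htop)
  obtain ⟨W, hW⟩ := exists_isIrreducible_lieSubmodule (F := F) (L := L)
    (V := MvPolynomial (Fin n) F ⧸ J.restrictScalars F)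
  have hWf : ∀ i, Polynomial.aeval (LieModule.toEnd F L W (e i)) (f i) =
      algebraMap F _ (a i) := by
    intro i
    ext w
    obtain ⟨g, hg⟩ := Submodule.mkQ_surjective _ (w : MvPolynomial (Fin n) F ⧸ J.restrictScalars F)
    have h1 := aeval_intertwine (A := LieModule.toEnd F L W (e i)) (B := ρ (e i))
      (T := (W.incl : W →ₗ[F] (MvPolynomial (Fin n) F ⧸ J.restrictScalars F))) (fun v ↦ rfl) (f i) w
    have h2 := aeval_intertwine (A := PBW.act e i) (B := ρ (e i))
      (T := (J.restrictScalars F).mkQ) (fun v ↦ by simp [ρ, PBW.rep_basis]) (f i) g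
    change _ = Polynomial.aeval (ρ (e i)) (f i)
      (w : MvPolynomial (Fin n) F ⧸ J.restrictScalars F) at h1
    rw [← hg, ← h2, hact] at h1
    refine h1.trans ?_
    change _ = a i • (w : MvPolynomial (Fin n) F ⧸ J.restrictScalars F)
    rw [← hg, ← map_smul, ← sub_eq_zero, ← map_sub, Submodule.mkQ_apply,
      Submodule.Quotient.mk_eq_zero, Submodule.restrictScalars_mem]
    have : Polynomial.aeval (X i) (f i) * g - a i • g =
        g * Polynomial.aeval (X i) (f i - Polynomial.C (a i)) := by
      rw [map_sub, Polynomial.aeval_C, Algebra.smul_def]; ring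
    rw [this]
    exact J.mul_mem_left _ (Ideal.subset_span ⟨i, rfl⟩)
  refine ⟨W, inferInstance, inferInstance, inferInstance, inferInstance, inferInstance, hW,
    fun i ↦ ⟨fun hai h0 ↦ hai ?_, fun had ↦ ?_⟩⟩
  · have := hWf i
    have hWn : Nontrivial W := LieModule.nontrivial_of_isIrreducible F L W
    rw [h0, ← map_zero (algebraMap F (Module.End F W)), Polynomial.aeval_algebraMap_apply] at this
    have := (algebraMap F (Module.End F W)).injective this
    rw [← this, Polynomial.aeval_def, Polynomial.eval₂_at_zero, hcoeff, map_zero]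
  · rw [← hWf i, hXp i had, map_pow, Polynomial.aeval_X]

end Reduced

section Schur

variable {F L V M : Type*} [Field F] [LieRing L] [AddCommGroup V] [Module F V]
  [LieRingModule L V] [AddCommGroup M] [Module F M] [LieRingModule L M]

lemma LieModule.IsIrreducible.injective (hV : LieModule.IsIrreducible F L V) {f : V →ₗ⁅F,L⁆ M}
    (hf : f ≠ 0) : Function.Injective f := by
  refine f.ker_eq_bot.mp ((hV.eq_bot_or_eq_top f.ker).resolve_right fun h ↦ hf ?_)
  ext v
  exact LieModuleHom.mem_ker.mp (h ▸ LieSubmodule.mem_top v)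

lemma LieModuleHom.sum_apply' {ι : Type*} (s : Finset ι) (f : ι → V →ₗ⁅F,L⁆ M) (v : V) :
    (∑ i ∈ s, f i) v = ∑ i ∈ s, f i v :=
  map_sum (⟨⟨fun g : V →ₗ⁅F,L⁆ M ↦ g v, rfl⟩, fun _ _ ↦ rfl⟩ : (V →ₗ⁅F,L⁆ M) →+ M) f s

lemma LieModule.IsIrreducible.isAtom_range (hV : LieModule.IsIrreducible F L V)
    {f : V →ₗ⁅F,L⁆ M} (hf : f ≠ 0) : IsAtom f.range := by
  refine ⟨fun h ↦ hf ?_, fun N hN ↦ ?_⟩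
  · ext v
    have : f v ∈ f.range := ⟨v, rfl⟩
    rwa [h, LieSubmodule.mem_bot] at this
  · rcases hV.eq_bot_or_eq_top (N.comap f) with h | h
    · rw [eq_bot_iff]
      intro x hx
      obtain ⟨v, rfl⟩ := hN.le hx
      have : v ∈ N.comap f := hx
      rw [h, LieSubmodule.mem_bot] at this
      simp [this]
    · refine absurd ?_ hN.not_ge
      rintro _ ⟨v, rfl⟩
      have : v ∈ N.comap f := h ▸ LieSubmodule.mem_top v
      exact this

variable [LieAlgebra F L] [LieModule F L V] [LieModule F L M]

lemma LieModule.IsIrreducible.exists_eq_algebraMap [IsAlgClosed F] [FiniteDimensional F V]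
    (hV : LieModule.IsIrreducible F L V) {T : Module.End F V}
    (hT : ∀ (x : L) (v : V), T ⁅x, v⁆ = ⁅x, T v⁆) : ∃ c : F, T = algebraMap F _ c := by
  have : Nontrivial V := LieModule.nontrivial_of_isIrreducible F L V
  obtain ⟨c, hc⟩ := Module.End.exists_eigenvalue T
  obtain ⟨v, hv⟩ := hc.exists_hasEigenvector
  let N : LieSubmodule F L V :=
    { Module.End.eigenspace T c with
      lie_mem := fun {x m} hm ↦ by
        have : T m = c • m := Module.End.mem_eigenspace_iff.mp hm
        exact Module.End.mem_eigenspace_iff.mpr (by rw [hT, this, lie_smul]) }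
  have hN : N = ⊤ := (hV.eq_bot_or_eq_top N).resolve_left fun h ↦ hv.2 <| by
    have : v ∈ N := hv.1
    rwa [h, LieSubmodule.mem_bot] at this
  refine ⟨c, LinearMap.ext fun w ↦ ?_⟩
  have : w ∈ N := hN ▸ LieSubmodule.mem_top w
  exact Module.End.mem_eigenspace_iff.mp this

lemma LieModule.IsIrreducible.exists_eq_smul [IsAlgClosed F] [FiniteDimensional F V]
    (hV : LieModule.IsIrreducible F L V) {f g : V →ₗ⁅F,L⁆ M} (hf : Function.Injective f)
    (h : ∀ v, g v ∈ f.range) : ∃ c : F, g = c • f := by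
  choose T hT using h
  let T' : Module.End F V :=
    { toFun := T
      map_add' := fun x y ↦ hf (by simp [hT])
      map_smul' := fun c x ↦ hf (by simp [hT]) }
  obtain ⟨c, hc⟩ := hV.exists_eq_algebraMap (T := T') fun x v ↦ hf (by simp [T', hT])
  refine ⟨c, ?_⟩
  ext v
  have h1 : T v = c • v := LinearMap.congr_fun hc v
  rw [← hT, h1]
  simp

lemma LieModule.IsIrreducible.eq_zero_of_sum_eq_zero {F L V : Type*} [Field F] [LieRing L]
    [LieAlgebra F L] [AddCommGroup V] [Module F V] [LieRingModule L V] [LieModule F L V]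
    [IsAlgClosed F] [FiniteDimensional F V] (hV : LieModule.IsIrreducible F L V) :
    ∀ {r : ℕ} {M : Type*} [AddCommGroup M] [Module F M] [LieRingModule L M] [LieModule F L M]
      {θ : Fin r → V →ₗ⁅F,L⁆ M} (_ : LinearIndependent F θ) {v : Fin r → V}
      (_ : ∑ i, θ i (v i) = 0), v = 0
  | 0, _, _, _, _, _, _, _, _, _ => Subsingleton.elim _ _
  | r + 1, M, _, _, _, _, θ, hθ, v, hv => by
    have hinj := hV.injective (hθ.ne_zero 0)
    have hθ' : LinearIndependent F
        fun i : Fin r ↦ (LieSubmodule.Quotient.mk' (θ 0).range).comp (θ i.succ) := by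
      rw [Fintype.linearIndependent_iff]
      intro c hc i
      obtain ⟨d, hd⟩ := hV.exists_eq_smul (g := ∑ i, c i • θ i.succ) hinj fun w ↦ by
        have := LieModuleHom.congr_fun hc w
        rw [← LieSubmodule.Quotient.mk_eq_zero, LieModuleHom.sum_apply', map_sum]
        rw [LieModuleHom.sum_apply'] at this
        simpa using this
      have := Fintype.linearIndependent_iff.mp hθ (Fin.cons (-d) c)
        (by simp [Fin.sum_univ_succ, hd]) i.succ
      simpa using this
    have h0 := eq_zero_of_sum_eq_zero hV hθ' (v := fun i ↦ v i.succ) (by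
      have : LieSubmodule.Quotient.mk' (θ 0).range (∑ i, θ i (v i)) = 0 := by rw [hv, map_zero]
      rw [Fin.sum_univ_succ, map_add, (LieSubmodule.Quotient.mk_eq_zero (θ 0).range).mpr
        (((θ 0).mem_range _).mpr ⟨v 0, rfl⟩), zero_add,
        map_sum] at this
      simpa using this)
    have h1 : ∀ i : Fin r, v i.succ = 0 := fun i ↦ congrFun h0 i
    simp only [Fin.sum_univ_succ, h1, map_zero, Finset.sum_const_zero, add_zero] at hv
    funext i
    refine Fin.cases (hinj (by simpa using hv)) h1 i

lemma LieModule.IsIrreducible.iSupIndep_range [IsAlgClosed F] [FiniteDimensional F V]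
    (hV : LieModule.IsIrreducible F L V) {r : ℕ} {θ : Fin r → V →ₗ⁅F,L⁆ M}
    (hθ : LinearIndependent F θ) : iSupIndep fun i ↦ (θ i).range := by
  classical
  rw [← LieSubmodule.iSupIndep_toSubmodule, iSupIndep_iff_finsetSum_eq_zero_imp_eq_zero]
  intro s w hw h0 i hi
  choose! v hv using hw
  have := congrFun (hV.eq_zero_of_sum_eq_zero hθ (v := fun i ↦ if i ∈ s then v i else 0) (by
    rw [← h0, ← Finset.sum_subset s.subset_univ fun i _ hi ↦ by simp [hi]]
    exact Finset.sum_congr rfl fun i hi ↦ by simpa [hi] using hv i hi)) i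
  simp only [hi, if_true, Pi.zero_apply] at this
  rw [← hv i hi, this]
  simp

/-- A nonzero morphism out of an irreducible module identifies it with its range. -/
noncomputable def LieModuleHom.equivRange (f : V →ₗ⁅F,L⁆ M) (hf : Function.Injective f) :
    V ≃ₗ⁅F,L⁆ f.range :=
  { LieModuleHom.codRestrict f.range f (fun m ↦ ⟨m, rfl⟩),
    LinearEquiv.ofInjective (f : V →ₗ[F] M) hf with }

end Schur

lemma card_le_finrank_of_linearIndependent {F L : Type} [Field F] [IsAlgClosed F] [LieRing L]
    [LieAlgebra F L] [FiniteDimensional F L] (hL : MultiplicityCondition F L) {A : LieIdeal F L}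
    (hA : LieModule.IsIrreducible F L A) (hab : ∀ a ∈ A, ∀ b ∈ A, ⁅a, b⁆ = (0 : L)) {r : ℕ}
    {θ : Fin r → A →ₗ⁅F,L⁆ L} (hθ : LinearIndependent F θ) : r ≤ Module.finrank F A := by
  rcases Nat.eq_zero_or_pos r with rfl | hr
  · exact Nat.zero_le _
  have hinj := fun i ↦ hA.injective (hθ.ne_zero i)
  let E := fun i ↦ (θ i).equivRange (hinj i)
  rw [(E ⟨0, hr⟩).toLinearEquiv.finrank_eq]
  refine hL r hr (fun i ↦ (θ i).range) (fun i ↦ hA.isAtom_range (hθ.ne_zero i)) ?_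
    (hA.iSupIndep_range hθ) fun i ↦ ⟨(E ⟨0, hr⟩).symm.trans (E i)⟩
  rintro i _ ⟨a, rfl⟩ _ ⟨b, rfl⟩
  have h1 : ⁅(b : L), a⁆ = 0 := Subtype.ext (hab b b.2 a a.2)
  have h2 : ⁅θ i a, b⁆ = 0 := Subtype.ext <| by
    rw [LieSubmodule.coe_bracket, ← lie_skew, ← LieModuleHom.map_lie, h1]
    simp
  rw [← LieModuleHom.map_lie, h2, map_zero]

lemma lie_eq_zero_of_disjoint {F L : Type*} [Field F] [LieRing L] [LieAlgebra F L]
    {A M : LieIdeal F L} (h : Disjoint M A) {m a : L} (hm : m ∈ M) (ha : a ∈ A) : ⁅m, a⁆ = 0 := by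
  have : ⁅m, a⁆ ∈ M ⊓ A := ⟨lie_mem_left F L M _ _ hm, A.lie_mem ha⟩
  rwa [h.eq_bot, LieSubmodule.mem_bot] at this

section Functional

variable {F L : Type} [Field F] [IsAlgClosed F] [LieRing L] [LieAlgebra F L] [FiniteDimensional F L]

lemma exists_dual_ne_comp (hL : MultiplicityCondition F L) {A M : LieIdeal F L} (hA : IsAtom A)
    (hab : ∀ a ∈ A, ∀ b ∈ A, ⁅a, b⁆ = (0 : L)) (hAM : ¬A ≤ M) (χ : Module.Dual F L) :
    ∃ ψ : Module.Dual F A, ∀ θ : A →ₗ⁅F,L⁆ L, (∀ a, θ a ∈ M) → ψ ≠ χ ∘ₗ (θ : A →ₗ[F] L) := by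
  by_contra! h
  let b := Module.finBasis F (Module.Dual F A)
  choose θ hθM hθ using fun i ↦ h (b i)
  let Φ : (A →ₗ⁅F,L⁆ L) →ₗ[F] Module.Dual F A :=
    { toFun := fun θ ↦ χ ∘ₗ (θ : A →ₗ[F] L)
      map_add' := fun x y ↦ by ext; simp
      map_smul' := fun c x ↦ by ext; simp }
  have h1 : LinearIndependent F θ := by
    refine LinearIndependent.of_comp Φ ?_
    convert b.linearIndependent using 1
    exact funext fun i ↦ (hθ i).symm
  have h2 : LieSubmodule.incl A ∉ Submodule.span F (Set.range θ) := by
    intro hmem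
    obtain ⟨c, hc⟩ := (Submodule.mem_span_range_iff_exists_fun F).mp hmem
    refine hAM fun a ha ↦ ?_
    have := LieModuleHom.congr_fun hc ⟨a, ha⟩
    rw [LieModuleHom.sum_apply', LieSubmodule.incl_apply] at this
    change _ = a at this
    rw [← this]
    exact sum_mem fun i _ ↦ M.smul_mem _ (hθM i _)
  have := card_le_finrank_of_linearIndependent hL hA.isIrreducible hab (h1.finCons h2)
  rw [Subspace.dual_finrank_eq] at this
  omega

lemma exists_functional_sup (hL : MultiplicityCondition F L) {A M : LieIdeal F L} (hA : IsAtom A)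
    (hab : ∀ a ∈ A, ∀ b ∈ A, ⁅a, b⁆ = (0 : L)) (hAM : ¬A ≤ M) {χ : Module.Dual F L}
    (hχ : ∀ B : LieIdeal F L, IsAtom B → B ≤ M → ∃ b ∈ B, χ b ≠ 0) :
    ∃ χ' : Module.Dual F L, ∀ B : LieIdeal F L, IsAtom B → B ≤ M ⊔ A → ∃ b ∈ B, χ' b ≠ 0 := by
  have hdisj : Disjoint M A := (hA.not_le_iff_disjoint.mp hAM).symm
  obtain ⟨ψ, hψ⟩ := exists_dual_ne_comp hL hA hab hAM χ
  obtain ⟨g, hg⟩ := LinearMap.exists_leftInverse_of_injective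
    ((LieSubmodule.toSubmodule M).mkQ ∘ₗ (LieSubmodule.incl A : A →ₗ[F] L)) (by
      rw [LinearMap.ker_eq_bot']
      intro a ha
      have h1 : (a : L) ∈ M := (Submodule.Quotient.mk_eq_zero _).mp ha
      have h2 : (a : L) ∈ M ⊓ A := ⟨h1, a.2⟩
      rw [hdisj.eq_bot, LieSubmodule.mem_bot] at h2
      exact Subtype.ext h2)
  let π : L →ₗ[F] A := g ∘ₗ (LieSubmodule.toSubmodule M).mkQ
  have hπM : ∀ m ∈ M, π m = 0 := fun m hm ↦ by
    have : (LieSubmodule.toSubmodule M).mkQ m = 0 := (Submodule.Quotient.mk_eq_zero _).mpr hm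
    rw [LinearMap.comp_apply, this, map_zero]
  have hπA : ∀ a : A, π a = a := fun a ↦ LinearMap.congr_fun hg a
  refine ⟨χ + (ψ - χ ∘ₗ (LieSubmodule.incl A : A →ₗ[F] L)) ∘ₗ π, fun B hB hBMA ↦ ?_⟩
  by_contra! hB0
  by_cases hBM : B ≤ M
  · obtain ⟨b, hb, hb0⟩ := hχ B hB hBM
    exact hb0 (by simpa [hπM b (hBM hb)] using hB0 b hb)
  have hBdisj : B ⊓ M = ⊥ := (hB.not_le_iff_disjoint.mp hBM).eq_bot
  have hdec : ∀ b ∈ B, b - π b ∈ M := fun b hb ↦ by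
    obtain ⟨m, hm, a, ha, rfl⟩ := (LieSubmodule.mem_sup _ _ _).mp (hBMA hb)
    rw [map_add, hπM m hm, zero_add, hπA ⟨a, ha⟩]
    simpa using hm
  let f : B →ₗ⁅F,L⁆ A :=
    { π ∘ₗ (LieSubmodule.incl B : B →ₗ[F] L) with
      map_lie' := fun {x b} ↦ by
        have h1 : ⁅x, (b : L) - π b⁆ ∈ M := M.lie_mem (hdec b b.2)
        have h2 := hπM _ h1
        rw [lie_sub, map_sub, ← LieSubmodule.coe_bracket A, hπA, sub_eq_zero] at h2
        exact h2 }
  have hf : ∀ b, f b = π b := fun b ↦ rfl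
  have hinj : Function.Injective f := by
    refine (injective_iff_map_eq_zero f).mpr fun b hb ↦ Subtype.ext ?_
    have h1 := hdec b b.2
    rw [← hf, hb] at h1
    have h2 : (b : L) ∈ B ⊓ M := ⟨b.2, by simpa using h1⟩
    rwa [hBdisj, LieSubmodule.mem_bot] at h2
  have hsurj : f.range = ⊤ := by
    refine (hA.isIrreducible.eq_bot_or_eq_top _).resolve_left fun h ↦ hB.1 ?_
    rw [eq_bot_iff]
    intro b hb
    have : f ⟨b, hb⟩ ∈ f.range := ⟨_, rfl⟩
    rw [h, LieSubmodule.mem_bot, ← map_zero f] at this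
    exact congrArg Subtype.val (hinj this)
  choose s hs using fun a : A ↦ (f.mem_range a).mp (hsurj ▸ LieSubmodule.mem_top a)
  let s' : A →ₗ⁅F,L⁆ B :=
    { toFun := s
      map_add' := fun x y ↦ hinj (by simp [hs])
      map_smul' := fun c x ↦ hinj (by simp [hs])
      map_lie' := fun {x a} ↦ hinj (by simp [hs]) }
  have hs' : ∀ a, a = π (s' a) := fun a ↦ (hs a).symm
  refine hψ (LieSubmodule.incl A - (LieSubmodule.incl B).comp s') (fun a ↦ ?_)
    (LinearMap.ext fun a ↦ ?_)
  · have h1 := M.neg_mem (hdec _ (s' a).2)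
    rw [← hs'] at h1
    simpa using h1
  · have h1 := hB0 _ (s' a).2
    simp only [LinearMap.add_apply, LinearMap.comp_apply, LinearMap.sub_apply, ← hs'] at h1
    change ψ a = χ ((a : L) - s' a)
    change χ (s' a) + (ψ a - χ a) = 0 at h1
    rw [map_sub, ← sub_eq_zero, ← h1]
    ring

theorem exists_abelian_ideal_functional (hL : MultiplicityCondition F L) :
    ∃ (M : LieIdeal F L) (χ : Module.Dual F L), (∀ a ∈ M, ∀ b ∈ M, ⁅a, b⁆ = (0 : L)) ∧
      (∀ A : LieIdeal F L, IsAtom A → (∀ a ∈ A, ∀ b ∈ A, ⁅a, b⁆ = (0 : L)) → A ≤ M) ∧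
      ∀ B : LieIdeal F L, IsAtom B → B ≤ M → ∃ b ∈ B, χ b ≠ 0 := by
  obtain ⟨M, ⟨hM, χ, hχ⟩, hmax⟩ := (wellFounded_gt (α := LieIdeal F L)).has_min
    {M | (∀ a ∈ M, ∀ b ∈ M, ⁅a, b⁆ = (0 : L)) ∧
      ∃ χ : Module.Dual F L, ∀ B : LieIdeal F L, IsAtom B → B ≤ M → ∃ b ∈ B, χ b ≠ 0}
    ⟨⊥, by simp, 0, fun B hB h ↦ absurd (le_bot_iff.mp h) hB.1⟩
  refine ⟨M, χ, hM, fun A hA hab ↦ ?_, hχ⟩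
  by_contra hAM
  have hdisj : Disjoint M A := (hA.not_le_iff_disjoint.mp hAM).symm
  refine hmax (M ⊔ A) ⟨fun x hx y hy ↦ ?_, exists_functional_sup hL hA hab hAM hχ⟩
    (left_lt_sup.mpr hAM)
  obtain ⟨m, hm, a, ha, rfl⟩ := (LieSubmodule.mem_sup _ _ _).mp hx
  obtain ⟨m', hm', a', ha', rfl⟩ := (LieSubmodule.mem_sup _ _ _).mp hy
  simp [hM m hm m' hm', hab a ha a' ha', lie_eq_zero_of_disjoint hdisj hm ha',
    lie_eq_zero_of_disjoint hdisj.symm ha hm']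

end Functional

section FaithfulIrreducible

variable {F L V : Type*} [Field F] [LieRing L] [LieAlgebra F L] [AddCommGroup V] [Module F V]
  [LieRingModule L V] [LieModule F L V] {p : ℕ} [CharP F p]

lemma ad_pow_eq_zero_of_mem_abelian (hp : p ≠ 0) {M : LieIdeal F L}
    (hM : ∀ a ∈ M, ∀ b ∈ M, ⁅a, b⁆ = (0 : L)) {m : L} (hm : m ∈ M) :
    LieAlgebra.ad F L m ^ p = 0 := by
  have hprime : p.Prime := (CharP.char_is_prime_or_zero F p).resolve_right hp
  refine pow_eq_zero_of_le hprime.two_le (LinearMap.ext fun y ↦ ?_)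
  simpa [pow_two] using hM m hm _ (lie_mem_left F L M m y hm)

lemma toEnd_commute_of_mem_abelian {M : LieIdeal F L}
    (hM : ∀ a ∈ M, ∀ b ∈ M, ⁅a, b⁆ = (0 : L)) {a b : L} (ha : a ∈ M) (hb : b ∈ M) :
    Commute (LieModule.toEnd F L V a) (LieModule.toEnd F L V b) := by
  refine LinearMap.ext fun v ↦ ?_
  have : ⁅⁅a, b⁆, v⁆ = 0 := by rw [hM a ha b hb, zero_lie]
  rwa [lie_lie, sub_eq_zero] at this

lemma charP_end [Nontrivial V] (p : ℕ) [CharP F p] : CharP (Module.End F V) p :=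
  charP_of_injective_algebraMap (algebraMap F _).injective p

lemma toEnd_add_pow (hp : p ≠ 0) [Nontrivial V] {M : LieIdeal F L}
    (hM : ∀ a ∈ M, ∀ b ∈ M, ⁅a, b⁆ = (0 : L)) {a b : L} (ha : a ∈ M) (hb : b ∈ M) :
    LieModule.toEnd F L V (a + b) ^ p =
      LieModule.toEnd F L V a ^ p + LieModule.toEnd F L V b ^ p := by
  have : Fact p.Prime := ⟨(CharP.char_is_prime_or_zero F p).resolve_right hp⟩
  have := charP_end (F := F) (V := V) p
  rw [map_add, add_pow_char_of_commute _ (toEnd_commute_of_mem_abelian hM ha hb)]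

lemma exists_functional_toEnd_pow [IsAlgClosed F] [FiniteDimensional F V] (hp : p ≠ 0)
    (hV : LieModule.IsIrreducible F L V) {M : LieIdeal F L}
    (hM : ∀ a ∈ M, ∀ b ∈ M, ⁅a, b⁆ = (0 : L)) :
    ∃ χ : Module.Dual F L, ∀ b ∈ M,
      LieModule.toEnd F L V b ^ p = algebraMap F (Module.End F V) (χ b ^ p) := by
  have : Nontrivial V := LieModule.nontrivial_of_isIrreducible F L V
  have : Fact p.Prime := ⟨(CharP.char_is_prime_or_zero F p).resolve_right hp⟩
  have hex : ∀ b : M, ∃ c : F,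
      LieModule.toEnd F L V b ^ p = algebraMap F (Module.End F V) (c ^ p) := fun b ↦ by
    obtain ⟨d, hd⟩ := hV.exists_eq_algebraMap (T := LieModule.toEnd F L V (b : L) ^ p)
      fun x v ↦ by
        have := rep_pow_commutator hp (ρ := (LieModule.toEnd F L V : L →ₗ[F] Module.End F V))
          (fun x y ↦ by simp [LieRing.of_associative_ring_bracket]) b x 1
        rw [pow_one, ad_pow_eq_zero_of_mem_abelian hp hM b.2, LinearMap.zero_apply, map_zero,
          sub_eq_zero] at this
        exact LinearMap.congr_fun this v
    obtain ⟨c, hc⟩ := IsAlgClosed.exists_pow_nat_eq d (Nat.pos_of_ne_zero hp)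
    exact ⟨c, by rw [hd, hc]⟩
  choose χ hχ using hex
  have huniq : ∀ {c d : F}, algebraMap F (Module.End F V) (c ^ p) = algebraMap F _ (d ^ p) →
      c = d := fun h ↦ frobenius_inj F p ((algebraMap F (Module.End F V)).injective h)
  let χ' : M →ₗ[F] F :=
    { toFun := χ
      map_add' := fun a b ↦ huniq <| by
        rw [← hχ, add_pow_char, map_add, ← hχ, ← hχ]
        exact toEnd_add_pow hp hM a.2 b.2
      map_smul' := fun c a ↦ huniq <| by
        rw [← hχ, RingHom.id_apply, smul_eq_mul, mul_pow, map_mul, ← hχ, ← Algebra.smul_def,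
          ← smul_pow, ← map_smul]
        rfl }
  obtain ⟨ψ, hψ⟩ := LinearMap.exists_extend (p := LieSubmodule.toSubmodule M) χ'
  refine ⟨ψ, fun b hb ↦ ?_⟩
  have h1 : ψ b = χ ⟨b, hb⟩ := LinearMap.congr_fun hψ ⟨b, hb⟩
  rw [h1, ← hχ]

/-- An ideal acting by nilpotent operators on an irreducible module acts trivially. -/
lemma toEnd_eq_zero_of_isNilpotent [FiniteDimensional F V] (hV : LieModule.IsIrreducible F L V)
    {K : LieIdeal F L} (hK : ∀ k ∈ K, IsNilpotent (LieModule.toEnd F L V k)) {k : L} (hk : k ∈ K) :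
    LieModule.toEnd F L V k = 0 := by
  have : Nontrivial V := LieModule.nontrivial_of_isIrreducible F L V
  have : LieModule.IsNilpotent K V :=
    (LieModule.isNilpotent_iff_forall' (R := F)).mpr fun k ↦ hK k k.2
  have := LieModule.nontrivial_max_triv_of_isNilpotent F K V
  obtain ⟨v, hv⟩ := exists_ne (0 : LieModule.maxTrivSubmodule F K V)
  let N : LieSubmodule F L V :=
    { LieSubmodule.toSubmodule (LieModule.maxTrivSubmodule F K V) with
      lie_mem := fun {x w} hw y ↦ by
        have h1 : ⁅(y : L), w⁆ = 0 := hw y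
        have h2 : ⁅⁅(y : L), x⁆, w⁆ = 0 := hw ⟨⁅(y : L), x⁆, lie_mem_left F L K _ _ y.2⟩
        change ⁅(y : L), ⁅x, w⁆⁆ = 0
        rw [leibniz_lie, h1, h2, lie_zero, add_zero] }
  have hN : N = ⊤ := (hV.eq_bot_or_eq_top N).resolve_left fun h ↦ hv <| by
    have : (v : V) ∈ N := v.2
    rw [h, LieSubmodule.mem_bot] at this
    exact Subtype.ext this
  ext w
  have : w ∈ N := hN ▸ LieSubmodule.mem_top w
  exact this ⟨k, hk⟩

lemma lie_eq_zero_of_mem_iSup {ι : Type*} {A : ι → LieIdeal F L}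
    (hab : ∀ i, ∀ a ∈ A i, ∀ b ∈ A i, ⁅a, b⁆ = (0 : L)) (hA : iSupIndep A) :
    ∀ a ∈ ⨆ i, A i, ∀ b ∈ ⨆ i, A i, ⁅a, b⁆ = (0 : L) := by
  intro a ha b hb
  induction ha using LieSubmodule.iSup_induction' with
  | zero => exact zero_lie b
  | add x y _ _ hx hy => rw [add_lie, hx, hy, add_zero]
  | mem i a ha =>
    induction hb using LieSubmodule.iSup_induction' with
    | zero => exact lie_zero a
    | add x y _ _ hx hy => rw [lie_add, hx, hy, add_zero]
    | mem j b hb =>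
      rcases eq_or_ne i j with rfl | hij
      · exact hab i a ha b hb
      · exact lie_eq_zero_of_disjoint (hA.pairwiseDisjoint hij) ha hb

end FaithfulIrreducible

lemma multiplicityCondition_of_faithfulIrredMod {F L : Type} [Field F] [IsAlgClosed F] [LieRing L]
    [LieAlgebra F L] [FiniteDimensional F L] {p : ℕ} [CharP F p] (hp : p ≠ 0)
    (X : FaithfulIrredMod F L) : MultiplicityCondition F L := by
  intro r hr A hA hab hind hφ
  have := X.finDim
  let φ := fun i ↦ (hφ i).some
  by_contra! hlt
  have hM := lie_eq_zero_of_mem_iSup hab hind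
  obtain ⟨χ, hχ⟩ := exists_functional_toEnd_pow hp X.irred hM
  let f : Fin r → A ⟨0, hr⟩ →ₗ⁅F,L⁆ L := fun i ↦
    (LieSubmodule.incl (A i)).comp (φ i).toLieModuleHom
  have hf : ∀ i a, f i a ∈ A i := fun i a ↦ (φ i a).2
  have hdep : ¬LinearIndependent F fun i ↦ χ ∘ₗ (f i : A ⟨0, hr⟩ →ₗ[F] L) := fun h ↦ by
    have := h.fintype_card_le_finrank
    rw [Fintype.card_fin, Subspace.dual_finrank_eq] at this
    omega
  rw [Fintype.not_linearIndependent_iff] at hdep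
  obtain ⟨c, hc, i, hi⟩ := hdep
  let θ : A ⟨0, hr⟩ →ₗ⁅F,L⁆ L := ∑ i, c i • f i
  have hθ : ∀ a, θ a = ∑ i, c i • f i a := fun a ↦ LieModuleHom.sum_apply' _ _ _
  have hmem : ∀ a, θ a ∈ ⨆ i, A i := fun a ↦ by
    rw [hθ]
    exact sum_mem fun i _ ↦ SMulMemClass.smul_mem _ (LieSubmodule.mem_iSup_of_mem i (hf i a))
  have hχθ : ∀ a, χ (θ a) = 0 := fun a ↦ by
    rw [hθ, map_sum]
    simpa using LinearMap.congr_fun hc a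
  have hzero : ∀ a, θ a = 0 := fun a ↦ by
    refine (map_eq_zero_iff _ X.faithful).mp ?_
    refine toEnd_eq_zero_of_isNilpotent X.irred (K := θ.range) ?_ ⟨a, rfl⟩
    rintro _ ⟨b, rfl⟩
    exact ⟨p, by rw [hχ _ (hmem b), hχθ, zero_pow hp, map_zero]⟩
  have hne := (hA ⟨0, hr⟩).1
  rw [Ne, LieSubmodule.eq_bot_iff] at hne
  push Not at hne
  obtain ⟨a, ha, ha0⟩ := hne
  have h1 := (iSupIndep_iff_finsetSum_eq_zero_imp_eq_zero _).mp
    (LieSubmodule.iSupIndep_toSubmodule.mpr hind) Finset.univ (fun i ↦ c i • f i ⟨a, ha⟩)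
    (fun i _ ↦ SMulMemClass.smul_mem _ (hf i _)) ((hθ _).symm.trans (hzero _)) i
    (Finset.mem_univ i)
  have h2 : φ i ⟨a, ha⟩ = 0 := Subtype.ext ((smul_eq_zero.mp h1).resolve_left hi)
  have h3 := (φ i).injective (h2.trans (map_zero (φ i).toLieModuleHom).symm)
  exact ha0 (congrArg Subtype.val h3)

lemma lie_self_eq_zero_of_isAtom {F L : Type*} [Field F] [LieRing L] [LieAlgebra F L]
    {N : LieIdeal F L} (hN : IsAtom N) {x : L} (hx : x ∈ N) (hx0 : x ≠ 0)
    (h : ∀ y ∈ N, ⁅x, y⁆ = 0) : ∀ a ∈ N, ∀ b ∈ N, ⁅a, b⁆ = (0 : L) := by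
  let Z : LieIdeal F L :=
    { carrier := {z | z ∈ N ∧ ∀ y ∈ N, ⁅z, y⁆ = 0}
      add_mem' := fun ha hb ↦ ⟨add_mem ha.1 hb.1, fun y hy ↦ by
        rw [add_lie, ha.2 y hy, hb.2 y hy, add_zero]⟩
      zero_mem' := ⟨zero_mem N, fun y _ ↦ zero_lie y⟩
      smul_mem' := fun c z hz ↦ ⟨SMulMemClass.smul_mem c hz.1, fun y hy ↦ by
        rw [smul_lie, hz.2 y hy, smul_zero]⟩
      lie_mem := fun {w z} hz ↦ ⟨N.lie_mem hz.1, fun y hy ↦ by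
        rw [lie_lie, hz.2 y hy, hz.2 _ (N.lie_mem hy), lie_zero, sub_zero]⟩ }
  have hZN : Z ≤ N := fun z hz ↦ hz.1
  have hxZ : x ∈ Z := ⟨hx, h⟩
  have hZ : Z = N := (hN.le_iff.mp hZN).resolve_left fun hZ ↦ hx0 <| by
    rwa [hZ, LieSubmodule.mem_bot] at hxZ
  intro a ha
  rw [← hZ] at ha
  exact ha.2

/-- Nonzero elements chosen in distinct minimal ideals not contained in `M` are linearly
independent modulo `M`, if `M` contains every abelian minimal ideal. -/
lemma linearIndependent_mk_of_isAtom {F L : Type*} [Field F] [LieRing L] [LieAlgebra F L]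
    {M : LieIdeal F L}
    (hM : ∀ A : LieIdeal F L, IsAtom A → (∀ a ∈ A, ∀ b ∈ A, ⁅a, b⁆ = (0 : L)) → A ≤ M)
    {x : {N : LieIdeal F L // IsAtom N ∧ ¬N ≤ M} → L} (hx : ∀ N, x N ∈ N.1)
    (hx0 : ∀ N, x N ≠ 0) :
    LinearIndependent F (Submodule.Quotient.mk (p := LieSubmodule.toSubmodule M) ∘ x) := by
  rw [linearIndependent_iff']
  intro s c hc N hN
  by_contra hcN
  have hmem : ∑ i ∈ s, c i • x i ∈ M := by
    refine (Submodule.Quotient.mk_eq_zero (LieSubmodule.toSubmodule M)).mp ?_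
    rw [← Submodule.mkQ_apply, map_sum]
    simpa using hc
  refine N.2.2 (hM N.1 N.2.1 (lie_self_eq_zero_of_isAtom N.2.1 (hx N) (hx0 N) fun y hy ↦ ?_))
  have h1 : ⁅∑ i ∈ s, c i • x i, y⁆ = 0 :=
    lie_eq_zero_of_disjoint (N.2.1.not_le_iff_disjoint.mp N.2.2).symm hmem hy
  rw [sum_lie, Finset.sum_eq_single_of_mem N hN, smul_lie] at h1
  · exact (smul_eq_zero.mp h1).resolve_left hcN
  · intro N' _ hne
    rw [smul_lie, lie_eq_zero_of_disjoint (N'.2.1.disjoint_of_ne N.2.1 (Subtype.coe_ne_coe.mpr hne))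
      (hx N') hy, smul_zero]

/-- A basis of `L` adapted to `M`: it contains a basis of `M`, and meets every minimal ideal
not contained in `M`. -/
lemma exists_adapted_basis {F L : Type*} [Field F] [LieRing L] [LieAlgebra F L]
    [FiniteDimensional F L] {M : LieIdeal F L}
    (hM : ∀ A : LieIdeal F L, IsAtom A → (∀ a ∈ A, ∀ b ∈ A, ⁅a, b⁆ = (0 : L)) → A ≤ M) :
    ∃ (n : ℕ) (e : Module.Basis (Fin n) F L),
      LieSubmodule.toSubmodule M ≤ Submodule.span F {y | y ∈ M ∧ y ∈ Set.range e} ∧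
      ∀ N : LieIdeal F L, IsAtom N → ¬N ≤ M → ∃ i, e i ∈ N := by
  have hex : ∀ N : {N : LieIdeal F L // IsAtom N ∧ ¬N ≤ M}, ∃ x ∈ N.1, x ≠ 0 := fun N ↦ by
    have := N.2.1.1
    rw [Ne, LieSubmodule.eq_bot_iff] at this
    push Not at this
    exact this
  choose x hx hx0 using hex
  let b := Module.finBasis F (LieSubmodule.toSubmodule M)
  have hv := b.linearIndependent.sumElim_of_quotient x (linearIndependent_mk_of_isAtom hM hx hx0)
  let B := Module.Basis.extend hv.linearIndepOn_id
  have hB : ∀ y ∈ Set.range (Sum.elim (fun i ↦ (b i : L)) x), y ∈ Set.range B := fun y hy ↦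
    ⟨⟨y, Module.Basis.subset_extend _ hy⟩, Module.Basis.extend_apply_self _ _⟩
  have := Module.Finite.finite_basis B
  obtain ⟨n, ⟨σ⟩⟩ := Finite.exists_equiv_fin (hv.linearIndepOn_id.extend (Set.subset_univ _))
  refine ⟨n, B.reindex σ, fun m hm ↦ ?_, fun N hN hNM ↦ ?_⟩
  · have h1 : (⟨m, hm⟩ : LieSubmodule.toSubmodule M) ∈ Submodule.span F (Set.range b) := by
      rw [b.span_eq]; trivial
    have h2 := Submodule.mem_map_of_mem (f := (LieSubmodule.toSubmodule M).subtype) h1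
    rw [Submodule.map_span] at h2
    refine Submodule.span_mono ?_ h2
    rintro _ ⟨_, ⟨i, rfl⟩, rfl⟩
    refine ⟨(b i).2, ?_⟩
    rw [B.range_reindex]
    exact hB _ ⟨Sum.inl i, rfl⟩
  · have h1 : x ⟨N, hN, hNM⟩ ∈ Set.range (B.reindex σ) := by
      rw [B.range_reindex]
      exact hB _ ⟨Sum.inr _, rfl⟩
    obtain ⟨i, hi⟩ := h1
    exact ⟨i, hi ▸ hx ⟨N, hN, hNM⟩⟩

lemma toEnd_injective_of_isAtom {F L V : Type*} [Field F] [LieRing L] [LieAlgebra F L]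
    [FiniteDimensional F L] [AddCommGroup V] [Module F V] [LieRingModule L V] [LieModule F L V]
    (h : ∀ B : LieIdeal F L, IsAtom B → ∃ b ∈ B, LieModule.toEnd F L V b ≠ 0) :
    Function.Injective (LieModule.toEnd F L V) := by
  let : LieRing (Module.End F V) := LieRing.ofAssociativeRing
  have hker : (LieModule.toEnd F L V).ker = ⊥ := by
    refine (IsAtomic.eq_bot_or_exists_atom_le _).resolve_right ?_
    rintro ⟨B, hB, hBK⟩
    obtain ⟨b, hb, hb0⟩ := h B hB
    exact hb0 (LieHom.mem_ker.mp (hBK hb))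
  refine (injective_iff_map_eq_zero _).mpr fun x hx ↦ ?_
  have : x ∈ (LieModule.toEnd F L V).ker := LieHom.mem_ker.mpr hx
  rwa [hker, LieSubmodule.mem_bot] at this

lemma nonempty_faithfulIrredMod {F L : Type} [Field F] [IsAlgClosed F] [LieRing L]
    [LieAlgebra F L] [FiniteDimensional F L] {p : ℕ} [CharP F p] (hp : p ≠ 0)
    (hL : MultiplicityCondition F L) : Nonempty (FaithfulIrredMod F L) := by
  classical
  have : Fact p.Prime := ⟨(CharP.char_is_prime_or_zero F p).resolve_right hp⟩
  obtain ⟨M, χ, hM, hatoms, hχ⟩ := exists_abelian_ideal_functional hL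
  obtain ⟨n, e, heM, he⟩ := exists_adapted_basis hatoms
  obtain ⟨V, _, _, _, _, hfin, hirr, hV⟩ := exists_irreducible_module hp e
    fun i ↦ if e i ∈ M then χ (e i) ^ p else 1
  have : Nontrivial V := LieModule.nontrivial_of_isIrreducible F L V
  have hpow : ∀ m ∈ M, LieModule.toEnd F L V m ^ p = algebraMap F _ (χ m ^ p) := fun m hm ↦ by
    suffices h : m ∈ M ∧ LieModule.toEnd F L V m ^ p = algebraMap F _ (χ m ^ p) from h.2
    have hm' := heM hm
    clear hm
    induction hm' using Submodule.span_induction with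
    | mem y hy =>
      obtain ⟨hyM, i, rfl⟩ := hy
      refine ⟨hyM, ?_⟩
      rw [(hV i).2 (ad_pow_eq_zero_of_mem_abelian hp hM hyM), if_pos hyM]
    | zero => simp [hp]
    | add y z _ _ hy hz =>
      refine ⟨add_mem hy.1 hz.1, ?_⟩
      rw [toEnd_add_pow hp hM hy.1 hz.1, hy.2, hz.2, map_add, add_pow_char, map_add]
    | smul c y _ hy =>
      refine ⟨SMulMemClass.smul_mem c hy.1, ?_⟩
      rw [map_smul, smul_pow, hy.2, map_smul, smul_eq_mul, mul_pow, map_mul, Algebra.smul_def]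
  refine ⟨⟨V, hfin, hirr, toEnd_injective_of_isAtom fun B hB ↦ ?_⟩⟩
  by_contra! hker
  by_cases hBM : B ≤ M
  · obtain ⟨b, hb, hb0⟩ := hχ B hB hBM
    have := hpow b (hBM hb)
    rw [hker b hb, zero_pow hp, eq_comm, map_eq_zero_iff _ (algebraMap F _).injective] at this
    exact hb0 (pow_eq_zero_iff hp |>.mp this)
  · obtain ⟨i, hi⟩ := he B hB hBM
    have hiM : e i ∉ M := fun h ↦ e.ne_zero i <| by
      have : e i ∈ B ⊓ M := ⟨hi, h⟩
      rwa [(hB.not_le_iff_disjoint.mp hBM).eq_bot, LieSubmodule.mem_bot] at this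
    exact (hV i).1 (by simp [hiM]) (hker _ hi)

/-- A finite-dimensional Lie algebra `L` over an algebraically closed
field of characteristic `p ≠ 0` has a finite-dimensional faithful irreducible module if
and only if for each abelian minimal ideal `A`, the multiplicity of the `L`-module
isomorphism type of `A` in the abelian socle is at most `dim_F A`. -/
theorem faithful_irreducible_iff_multiplicity_condition
    {F L : Type} [Field F] [IsAlgClosed F] [LieRing L] [LieAlgebra F L] {p : ℕ}
    [CharP F p] (hp : p ≠ 0) [FiniteDimensional F L] :
    Nonempty (FaithfulIrredMod F L) ↔ MultiplicityCondition F L := by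
  exact ⟨fun ⟨X⟩ ↦ multiplicityCondition_of_faithfulIrredMod hp X, nonempty_faithfulIrredMod hp⟩
end
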